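/- arXiv:2405.02736 — 3 statements merged into one kernel-verified Lean document; each statement's English description precedes it below -/
import Mathlib

section
/- Let A be a finite-dimensional algebra over a field k, let Q be a finitely generated left A-module, and let 0 → X_{n-l} → Q_{n-l-1} → ⋯ → Q_1 → Q_0 → X_0 → 0 be an exact sequence of finitely generated left A-modules with each Q_i in add(Q). If the projective dimension of X_0 is at most n and the projective dimension of Q equals l with n > l, then the projective dimension of X_{n-l} is at most l. -/
universe u
open MulOpposite

noncomputable section
namespace Paper

section RingDefs
variable (B : Type u) [Ring B]

/-- `X` belongs to `add Q`: it is a direct summand of a finite direct sum of copies of `Q`. -/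
def InAdd (Q X : ModuleCat.{u} B) : Prop :=
  ∃ (n : ℕ) (s : X →ₗ[B] (Fin n → Q)) (r : (Fin n → Q) →ₗ[B] X), r ∘ₗ s = LinearMap.id

/-- A superfluous (small) submodule. -/
def Superfluous {P : ModuleCat.{u} B} (N : Submodule B P) : Prop :=
  ∀ K : Submodule B P, K ⊔ N = ⊤ → K = ⊤

/-- An essential (large) submodule. -/
def Essential {P : ModuleCat.{u} B} (N : Submodule B P) : Prop :=
  ∀ K : Submodule B P, K ⊓ N = ⊥ → K = ⊥

/-- `p : P → X` is a projective cover. -/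
def IsProjCover {P X : ModuleCat.{u} B} (p : P →ₗ[B] X) : Prop :=
  Module.Projective B P ∧ Function.Surjective p ∧ Superfluous B (LinearMap.ker p)

/-- `ι : X → I` is an injective envelope. -/
def IsInjEnvelope {X I : ModuleCat.{u} B} (ι : X →ₗ[B] I) : Prop :=
  Module.Injective B I ∧ Function.Injective ι ∧ Essential B (LinearMap.range ι)

/-- The zero module. -/
def zeroMod : ModuleCat.{u} B := ModuleCat.of B PUnit

/-- An exact sequence `0 → P_m → ⋯ → P_1 → P_0 → X → 0` whose terms satisfy the
predicate `T` and which remains exact under `Hom(test, −)`. -/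
def ResLE (test : ModuleCat.{u} B) (T : ModuleCat.{u} B → Prop)
    (X : ModuleCat.{u} B) (m : ℕ) : Prop :=
  ∃ (P : ℕ → ModuleCat.{u} B) (d : ∀ j, P (j+1) →ₗ[B] P j) (aug : P 0 →ₗ[B] X),
    (∀ j, j ≤ m → T (P j)) ∧ (∀ j, m < j → Subsingleton (P j)) ∧
    Function.Surjective aug ∧ Function.Exact (d 0) aug ∧
    (∀ j, Function.Exact (d (j+1)) (d j)) ∧
    (∀ f : test →ₗ[B] X, ∃ h : test →ₗ[B] P 0, aug ∘ₗ h = f) ∧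
    (∀ f : test →ₗ[B] P 0, aug ∘ₗ f = 0 → ∃ h : test →ₗ[B] P 1, d 0 ∘ₗ h = f) ∧
    (∀ j, ∀ f : test →ₗ[B] P (j+1), d j ∘ₗ f = 0 →
      ∃ h : test →ₗ[B] P (j+2), d (j+1) ∘ₗ h = f)

/-- An exact sequence `0 → X → I_0 → ⋯ → I_m → 0` whose terms satisfy the predicate `T`
and which remains exact under `Hom(−, test)`. -/
def CoresLE (test : ModuleCat.{u} B) (T : ModuleCat.{u} B → Prop)
    (X : ModuleCat.{u} B) (m : ℕ) : Prop :=
  ∃ (M : ℕ → ModuleCat.{u} B) (ι : X →ₗ[B] M 0) (d : ∀ j, M j →ₗ[B] M (j+1)),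
    (∀ j, j ≤ m → T (M j)) ∧ (∀ j, m < j → Subsingleton (M j)) ∧
    Function.Injective ι ∧ Function.Exact ι (d 0) ∧
    (∀ j, Function.Exact (d j) (d (j+1))) ∧
    (∀ f : X →ₗ[B] test, ∃ h : M 0 →ₗ[B] test, h ∘ₗ ι = f) ∧
    (∀ f : M 0 →ₗ[B] test, f ∘ₗ ι = 0 → ∃ h : M 1 →ₗ[B] test, h ∘ₗ d 0 = f) ∧
    (∀ j, ∀ f : M (j+1) →ₗ[B] test, f ∘ₗ d j = 0 →
      ∃ h : M (j+2) →ₗ[B] test, h ∘ₗ d (j+1) = f)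

/-- Projective dimension at most `n`. -/
def pdLE (X : ModuleCat.{u} B) (n : ℕ) : Prop :=
  ResLE B (zeroMod B) (fun P => Module.Projective B P) X n

/-- Injective dimension at most `n`. -/
def idLE (X : ModuleCat.{u} B) (n : ℕ) : Prop :=
  CoresLE B (zeroMod B) (fun I => Module.Injective B I) X n

/-- Projective dimension equal to `n`. -/
def pdEq (X : ModuleCat.{u} B) (n : ℕ) : Prop :=
  pdLE B X n ∧ ∀ j, pdLE B X j → n ≤ j

/-- Injective dimension equal to `n`. -/
def idEq (X : ModuleCat.{u} B) (n : ℕ) : Prop :=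
  idLE B X n ∧ ∀ j, idLE B X j → n ≤ j

/-- Projective dimension as an element of `ℕ∞`. -/
def pdDim (X : ModuleCat.{u} B) : ℕ∞ :=
  sInf {c : ℕ∞ | ∃ n : ℕ, c = n ∧ pdLE B X n}

/-- Injective dimension as an element of `ℕ∞`. -/
def idDim (X : ModuleCat.{u} B) : ℕ∞ :=
  sInf {c : ℕ∞ | ∃ n : ℕ, c = n ∧ idLE B X n}

/-- Relative dominant dimension of `X` with respect to `Q` is at least `n`:
there is an exact sequence `0 → X → Q_1 → ⋯ → Q_n` with `Q_i ∈ add Q`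
remaining exact under `Hom(−, Q)`. -/
def domdimGE (Q X : ModuleCat.{u} B) (n : ℕ) : Prop :=
  n = 0 ∨ ∃ (M : ℕ → ModuleCat.{u} B) (ι : X →ₗ[B] M 0) (d : ∀ j, M j →ₗ[B] M (j+1)),
    (∀ j, j + 1 ≤ n → InAdd B Q (M j)) ∧
    Function.Injective ι ∧ (2 ≤ n → Function.Exact ι (d 0)) ∧
    (∀ j, j + 3 ≤ n → Function.Exact (d j) (d (j+1))) ∧
    (∀ f : X →ₗ[B] Q, ∃ h : M 0 →ₗ[B] Q, h ∘ₗ ι = f) ∧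
    (2 ≤ n → ∀ f : M 0 →ₗ[B] Q, f ∘ₗ ι = 0 → ∃ h : M 1 →ₗ[B] Q, h ∘ₗ d 0 = f) ∧
    (∀ j, j + 3 ≤ n → ∀ f : M (j+1) →ₗ[B] Q, f ∘ₗ d j = 0 →
      ∃ h : M (j+2) →ₗ[B] Q, h ∘ₗ d (j+1) = f)

/-- Relative codominant dimension of `X` with respect to `Q` is at least `n`. -/
def codomdimGE (Q X : ModuleCat.{u} B) (n : ℕ) : Prop :=
  n = 0 ∨ ∃ (M : ℕ → ModuleCat.{u} B) (aug : M 0 →ₗ[B] X) (d : ∀ j, M (j+1) →ₗ[B] M j),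
    (∀ j, j + 1 ≤ n → InAdd B Q (M j)) ∧
    Function.Surjective aug ∧ (2 ≤ n → Function.Exact (d 0) aug) ∧
    (∀ j, j + 3 ≤ n → Function.Exact (d (j+1)) (d j)) ∧
    (∀ f : Q →ₗ[B] X, ∃ h : Q →ₗ[B] M 0, aug ∘ₗ h = f) ∧
    (2 ≤ n → ∀ f : Q →ₗ[B] M 0, aug ∘ₗ f = 0 → ∃ h : Q →ₗ[B] M 1, d 0 ∘ₗ h = f) ∧
    (∀ j, j + 3 ≤ n → ∀ f : Q →ₗ[B] M (j+1), d j ∘ₗ f = 0 →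
      ∃ h : Q →ₗ[B] M (j+2), d (j+1) ∘ₗ h = f)

/-- Relative dominant dimension with respect to `Q`, as an element of `ℕ∞`. -/
def relDomDim (Q X : ModuleCat.{u} B) : ℕ∞ :=
  sSup {c : ℕ∞ | ∃ n : ℕ, c = n ∧ domdimGE B Q X n}

/-- Relative codominant dimension with respect to `Q`, as an element of `ℕ∞`. -/
def relCodomDim (Q X : ModuleCat.{u} B) : ℕ∞ :=
  sSup {c : ℕ∞ | ∃ n : ℕ, c = n ∧ codomdimGE B Q X n}

/-- A projective resolution. -/
structure ProjRes (X : ModuleCat.{u} B) where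
  P : ℕ → ModuleCat.{u} B
  d : ∀ j, P (j+1) →ₗ[B] P j
  aug : P 0 →ₗ[B] X
  proj : ∀ j, Module.Projective B (P j)
  augSurj : Function.Surjective aug
  exact0 : Function.Exact (d 0) aug
  exact : ∀ j, Function.Exact (d (j+1)) (d j)

/-- Vanishing of `Ext^i(X, Y)`, expressed via projective resolutions. -/
def ExtVanish (X Y : ModuleCat.{u} B) : ℕ → Prop
  | 0 => Subsingleton (X →ₗ[B] Y)
  | (i+1) => ∀ R : ProjRes B X, ∀ f : R.P (i+1) →ₗ[B] Y,
      f ∘ₗ R.d (i+1) = 0 → ∃ g : R.P i →ₗ[B] Y, f = g ∘ₗ R.d i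

/-- `Q` is self-orthogonal: `Ext^i(Q, Q) = 0` for all `i > 0`. -/
def SelfOrth (Q : ModuleCat.{u} B) : Prop := ∀ i, 1 ≤ i → ExtVanish B Q Q i

/-- `Z` is a (first, minimal) syzygy of `X`. -/
def IsSyzygyOf (X Z : ModuleCat.{u} B) : Prop :=
  ∃ (P : ModuleCat.{u} B) (p : P →ₗ[B] X), IsProjCover B p ∧
    Nonempty (Z ≃ₗ[B] LinearMap.ker p)

/-- `Z` is an `n`-th syzygy `Ω^n X`. -/
def IsOmegaOf : ℕ → ModuleCat.{u} B → ModuleCat.{u} B → Prop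
  | 0, X, Z => Nonempty (Z ≃ₗ[B] X)
  | (n+1), X, Z => ∃ Y, IsSyzygyOf B X Y ∧ IsOmegaOf n Y Z

/-- `Z` is a (first, minimal) cosyzygy of `X`. -/
def IsCosyzygyOf (X Z : ModuleCat.{u} B) : Prop :=
  ∃ (I : ModuleCat.{u} B) (ι : X →ₗ[B] I), IsInjEnvelope B ι ∧
    Nonempty (Z ≃ₗ[B] (I ⧸ LinearMap.range ι))

/-- `Z` is an `n`-th cosyzygy `Ω^{-n} X`. -/
def IsOmegaInvOf : ℕ → ModuleCat.{u} B → ModuleCat.{u} B → Prop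
  | 0, X, Z => Nonempty (Z ≃ₗ[B] X)
  | (n+1), X, Z => ∃ Y, IsCosyzygyOf B X Y ∧ IsOmegaInvOf n Y Z

/-- Precomposition with `g`, as a map of right `B`-modules `Hom(P₀,B) → Hom(P₁,B)`. -/
def lprecomp {P1 P0 : ModuleCat.{u} B} (g : P1 →ₗ[B] P0) :
    (P0 →ₗ[B] B) →ₗ[Bᵐᵒᵖ] (P1 →ₗ[B] B) where
  toFun h := h ∘ₗ g
  map_add' _ _ := rfl
  map_smul' _ _ := rfl

/-- `T` is a transpose `Tr X` (computed from a minimal projective presentation). -/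
def IsTransposeOf (X : ModuleCat.{u} B) (T : ModuleCat.{u} Bᵐᵒᵖ) : Prop :=
  ∃ (P1 P0 : ModuleCat.{u} B) (g : P1 →ₗ[B] P0) (p : P0 →ₗ[B] X),
    IsProjCover B p ∧ Module.Projective B P1 ∧ Function.Exact g p ∧
    Superfluous B (LinearMap.ker g) ∧
    Nonempty (T ≃ₗ[Bᵐᵒᵖ] ((P1 →ₗ[B] B) ⧸ LinearMap.range (lprecomp B g)))

/-- The canonical ring homomorphism `B →+* Bᵐᵒᵖᵐᵒᵖ`. -/
def opOpHom : B →+* Bᵐᵒᵖᵐᵒᵖ where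
  toFun b := op (op b)
  map_one' := rfl
  map_mul' _ _ := rfl
  map_zero' := rfl
  map_add' _ _ := rfl


/-- An `F_Mo`-projective resolution: terms in `add(B ⊕ Mo)`, exact, and remaining
exact under `Hom(Mo, −)`. -/
structure FProjRes (Mo X : ModuleCat.{u} B) where
  P : ℕ → ModuleCat.{u} B
  d : ∀ j, P (j+1) →ₗ[B] P j
  aug : P 0 →ₗ[B] X
  mem : ∀ j, InAdd B (ModuleCat.of B (B × Mo)) (P j)
  augSurj : Function.Surjective aug
  exact0 : Function.Exact (d 0) aug
  exact : ∀ j, Function.Exact (d (j+1)) (d j)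
  lift0 : ∀ f : Mo →ₗ[B] X, ∃ h : Mo →ₗ[B] P 0, aug ∘ₗ h = f
  lift1 : ∀ f : Mo →ₗ[B] P 0, aug ∘ₗ f = 0 → ∃ h : Mo →ₗ[B] P 1, d 0 ∘ₗ h = f
  lift : ∀ j, ∀ f : Mo →ₗ[B] P (j+1), d j ∘ₗ f = 0 →
    ∃ h : Mo →ₗ[B] P (j+2), d (j+1) ∘ₗ h = f

/-- Vanishing of the relative extension group `Ext^i_{F_Mo}(X, Y)`, computed via
`F_Mo`-projective resolutions. -/
def FExtVanish (Mo X Y : ModuleCat.{u} B) : ℕ → Prop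
  | 0 => True
  | (i+1) => ∀ R : FProjRes B Mo X, ∀ f : R.P (i+1) →ₗ[B] Y,
      f ∘ₗ R.d (i+1) = 0 → ∃ g : R.P i →ₗ[B] Y, f = g ∘ₗ R.d i

end RingDefs

section Duality
variable (k : Type u) [Field k] (B : Type u) [Ring B] [Algebra k B]

noncomputable instance kmod (X : ModuleCat.{u} B) : Module k X :=
  Module.compHom X (algebraMap k B)

instance kmodSMulComm (X : ModuleCat.{u} B) : SMulCommClass B k X :=
  ⟨fun b c x => by
    show b • ((algebraMap k B c) • x) = (algebraMap k B c) • (b • x)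
    rw [← mul_smul, ← mul_smul, Algebra.commutes]⟩

instance kmodTower (X : ModuleCat.{u} B) : IsScalarTower k B X :=
  ⟨fun c b x => by
    show (c • b) • x = (algebraMap k B c) • (b • x)
    rw [Algebra.smul_def, mul_smul]⟩

noncomputable instance dualModL (X : ModuleCat.{u} B) : Module Bᵐᵒᵖ (X →ₗ[k] k) where
  smul b φ := φ ∘ₗ (DistribMulAction.toLinearMap k X b.unop)
  one_smul φ := by
    ext x
    show φ ((1 : Bᵐᵒᵖ).unop • x) = φ x
    rw [unop_one, one_smul]
  mul_smul b c φ := by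
    ext x
    show φ ((b * c).unop • x) = φ (c.unop • b.unop • x)
    rw [unop_mul, mul_smul]
  smul_zero b := rfl
  smul_add b φ ψ := rfl
  add_smul b c φ := by
    ext x
    show φ ((b + c).unop • x) = φ (b.unop • x) + φ (c.unop • x)
    rw [unop_add, add_smul, map_add]
  zero_smul φ := by
    ext x
    show φ ((0 : Bᵐᵒᵖ).unop • x) = 0
    rw [unop_zero, zero_smul, map_zero]

/-- The standard duality `D = Hom_k(−, k)`, sending a left `B`-module to a right
`B`-module. -/
def Dop (X : ModuleCat.{u} B) : ModuleCat.{u} Bᵐᵒᵖ :=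
  ModuleCat.of Bᵐᵒᵖ (X →ₗ[k] k)

noncomputable instance dualModR (Y : ModuleCat.{u} Bᵐᵒᵖ) : Module B (Y →ₗ[k] k) where
  smul b φ := φ ∘ₗ (DistribMulAction.toLinearMap k Y (op b))
  one_smul φ := by
    ext x
    show φ ((op (1:B)) • x) = φ x
    rw [op_one, one_smul]
  mul_smul b c φ := by
    ext x
    show φ ((op (b * c)) • x) = φ ((op c) • (op b) • x)
    rw [op_mul, mul_smul]
  smul_zero b := rfl
  smul_add b φ ψ := rfl
  add_smul b c φ := by
    ext x
    show φ ((op (b + c)) • x) = φ ((op b) • x) + φ ((op c) • x)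
    rw [op_add, add_smul, map_add]
  zero_smul φ := by
    ext x
    show φ ((op (0 : B)) • x) = 0
    rw [op_zero, zero_smul, map_zero]

/-- The standard duality `D = Hom_k(−, k)`, sending a right `B`-module to a left
`B`-module. -/
def Dunop (Y : ModuleCat.{u} Bᵐᵒᵖ) : ModuleCat.{u} B :=
  ModuleCat.of B (Y →ₗ[k] k)

/-- `D(B_B)`, the standard injective cogenerator of `B`-Mod. -/
def Dcogen : ModuleCat.{u} B := Dunop k B (ModuleCat.of Bᵐᵒᵖ B)

/-- `T ≅ τ X = D Tr X`, the Auslander–Reiten translate. -/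
def IsTauOf (X T : ModuleCat.{u} B) : Prop :=
  ∃ Tr : ModuleCat.{u} Bᵐᵒᵖ, IsTransposeOf B X Tr ∧ Nonempty (T ≃ₗ[B] Dunop k B Tr)

/-- `T ≅ τ_n X = τ Ω^{n-1} X`. -/
def IsTauN (n : ℕ) (X T : ModuleCat.{u} B) : Prop :=
  ∃ Z, IsOmegaOf B (n-1) X Z ∧ IsTauOf k B Z T

/-- `T ≅ τ⁻ X = Tr D X`, the inverse Auslander–Reiten translate. -/
def IsTauInvOf (X T : ModuleCat.{u} B) : Prop :=
  ∃ Tr2 : ModuleCat.{u} Bᵐᵒᵖᵐᵒᵖ, IsTransposeOf Bᵐᵒᵖ (Dop k B X) Tr2 ∧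
    Nonempty (T ≃ₗ[B] ((ModuleCat.restrictScalars (opOpHom B)).obj Tr2))

/-- `T ≅ τ⁻_n X = τ⁻ Ω^{-(n-1)} X`. -/
def IsTauInvN (n : ℕ) (X T : ModuleCat.{u} B) : Prop :=
  ∃ Z, IsOmegaInvOf B (n-1) X Z ∧ IsTauInvOf k B Z T

/-- The Nakayama functor `ν = D Hom_B(−, B)` (on objects). -/
def nu (X : ModuleCat.{u} B) : ModuleCat.{u} B :=
  Dunop k B (ModuleCat.of Bᵐᵒᵖ (X →ₗ[B] B))

/-- The inverse Nakayama functor `ν⁻ = Hom_B(D(−), B)` (on objects). -/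
def nuInv (X : ModuleCat.{u} B) : ModuleCat.{u} B :=
  (ModuleCat.restrictScalars (opOpHom B)).obj
    (ModuleCat.of Bᵐᵒᵖᵐᵒᵖ ((Dop k B X) →ₗ[Bᵐᵒᵖ] Bᵐᵒᵖ))

/-- Relative `add Q`-dimension of `X` is at most `m`. -/
def RelAddDimLE (Q X : ModuleCat.{u} B) (m : ℕ) : Prop :=
  ResLE B Q (InAdd B Q) X m

/-- Relative `add Q`-codimension of `X` is at most `m`. -/
def RelAddCodimLE (Q X : ModuleCat.{u} B) (m : ℕ) : Prop :=
  CoresLE B Q (InAdd B Q) X m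

/-- `Q` is an `l`-quasi-generator (without minimality of `l`). -/
def QuasiGenLE (Q : ModuleCat.{u} B) (l : ℕ) : Prop :=
  CoresLE B Q (InAdd B Q) (ModuleCat.of B B) l

/-- `Q` is an `l`-quasi-generator: `l` is minimal. -/
def IsQuasiGen (Q : ModuleCat.{u} B) (l : ℕ) : Prop :=
  QuasiGenLE B Q l ∧ ∀ j, QuasiGenLE B Q j → l ≤ j

/-- `Q` is an `m`-quasi-cogenerator (without minimality of `m`). -/
def QuasiCogenLE (Q : ModuleCat.{u} B) (m : ℕ) : Prop :=
  ResLE B Q (InAdd B Q) (Dcogen k B) m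

/-- `Q` is an `m`-quasi-cogenerator: `m` is minimal. -/
def IsQuasiCogen (Q : ModuleCat.{u} B) (m : ℕ) : Prop :=
  QuasiCogenLE k B Q m ∧ ∀ j, QuasiCogenLE k B Q j → m ≤ j

/-- `(B, Q)` is a relative `n`-Auslander–Gorenstein pair. -/
def IsRelAGPair (Q : ModuleCat.{u} B) (n : ℕ) : Prop :=
  idLE B (ModuleCat.of B B) n ∧ idLE Bᵐᵒᵖ (ModuleCat.of Bᵐᵒᵖ Bᵐᵒᵖ) n ∧
  SelfOrth B Q ∧ domdimGE B Q (ModuleCat.of B B) n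

/-- `Q` is an `(n, m, l)`-quasi-precluster tilting module. -/
def IsQPCT (Q : ModuleCat.{u} B) (n m l : ℕ) : Prop :=
  (∀ i, 1 ≤ i → i ≤ n - 2 → ExtVanish B Q Q i) ∧
  IsQuasiGen B Q l ∧
  IsQuasiCogen k B Q m ∧
  (∃ T, IsTauN k B (n - m - 1) Q T ∧ RelAddDimLE B Q T m) ∧
  (∃ T, IsTauInvN k B (n - l - 1) Q T ∧ RelAddCodimLE B Q T l)

/-- Precomposition with `g`, as a `k`-linear map between Hom spaces. -/
def pcompk {X Y Z : ModuleCat.{u} B} (g : X →ₗ[B] Y) :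
    (Y →ₗ[B] Z) →ₗ[k] (X →ₗ[B] Z) where
  toFun h := h ∘ₗ g
  map_add' _ _ := rfl
  map_smul' _ _ := rfl


/-- `I` is an injective object for the exact structure `F_Mo`: it lies in
`add(DB ⊕ τ Mo)`. -/
def IsFInj (Mo I : ModuleCat.{u} B) : Prop :=
  ∃ T, IsTauOf k B Mo T ∧ InAdd B (ModuleCat.of B ((Dcogen k B) × T)) I

/-- `T` is an `F_Mo`-cotilting object: finite relative injective dimension, no relative
self-extensions, and the relative injectives `DB ⊕ τ Mo` admit a finite `F_Mo`-exact
resolution by objects of `add T`. -/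
def FCotilting (Mo T : ModuleCat.{u} B) : Prop :=
  (∃ r, CoresLE B Mo (IsFInj k B Mo) T r) ∧
  (∀ i, 1 ≤ i → FExtVanish B Mo T T i) ∧
  (∃ τM, IsTauOf k B Mo τM ∧
    ∃ r, ResLE B Mo (InAdd B T) (ModuleCat.of B ((Dcogen k B) × τM)) r)

end Duality

section EndStuff
variable (A : Type u) [Ring A] (Q : ModuleCat.{u} A)

/-- The canonical ring homomorphism `A → End_{End_A(Q)}(Q)`. -/
def toEndE : A →+* Module.End (Module.End A Q) Q where
  toFun a :=
    { toFun := fun q => a • q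
      map_add' := fun x y => smul_add a x y
      map_smul' := fun e q => (e.map_smul a q).symm }
  map_one' := by ext q; exact one_smul A q
  map_mul' x y := by ext q; exact mul_smul x y q
  map_zero' := by ext q; exact zero_smul A q
  map_add' x y := by ext q; exact add_smul x y q

/-- `Hom_A(Q, X)` as a left module over `End_A(Q)ᵐᵒᵖ` (i.e. a left `Λ`-module) by
precomposition. -/
noncomputable instance homPrecompMod (X : ModuleCat.{u} A) :
    Module (Module.End A Q)ᵐᵒᵖ (Q →ₗ[A] X) where
  smul e f := f ∘ₗ e.unop
  one_smul f := by ext q; rfl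
  mul_smul e e' f := by ext q; rfl
  smul_zero e := rfl
  smul_add e f g := rfl
  add_smul e e' f := by ext q; exact map_add f _ _
  zero_smul f := by ext q; exact map_zero f

/-- The actions of `A` and of `End_A(Q)` on `Q` commute. -/
instance endSMulComm : SMulCommClass (Module.End A Q) A Q :=
  ⟨fun e a q => e.map_smul a q⟩

instance endSMulComm' : SMulCommClass A (Module.End A Q) Q :=
  ⟨fun a e q => (e.map_smul a q).symm⟩

end EndStuff

end Paper
end

namespace PdAux
open CategoryTheory Paper

variable {A : Type} [Ring A]

/-- Short exactness packaged from linear maps. -/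
lemma ses {X Y Z : ModuleCat.{0} A} (f : X →ₗ[A] Y) (g : Y →ₗ[A] Z)
    (hf : Function.Injective f) (hg : Function.Surjective g) (h : Function.Exact f g) :
    ∃ w, (ShortComplex.mk (ModuleCat.ofHom f) (ModuleCat.ofHom g) w).ShortExact := by
  refine ⟨by ext x; exact h.apply_apply_eq_zero x, ?_⟩
  refine ShortComplex.ShortExact.mk' ?_ ?_ ?_
  · rw [ShortComplex.ShortExact.moduleCat_exact_iff_function_exact]
    exact h
  · exact (ModuleCat.mono_iff_injective _).2 hf
  · exact (ModuleCat.epi_iff_surjective _).2 hg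

lemma hpd_of_subsingleton (X : ModuleCat.{0} A) [Subsingleton X] (n : ℕ) :
    HasProjectiveDimensionLT X n := by
  have := (ModuleCat.isZero_of_subsingleton X).hasProjectiveDimensionLT_zero
  exact hasProjectiveDimensionLT_of_ge X 0 n (Nat.zero_le _)

lemma hpd_one (X : ModuleCat.{0} A) (h : Module.Projective A X) (n : ℕ) :
    HasProjectiveDimensionLT X (n + 1) := by
  have : Projective X := (IsProjective.iff_projective X).1 h
  exact hasProjectiveDimensionLT_of_ge X 1 (n + 1) (by omega)

lemma hpd_fin (Q : ModuleCat.{0} A) (m : ℕ) (h : HasProjectiveDimensionLT Q m) (n : ℕ) :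
    HasProjectiveDimensionLT (ModuleCat.of A (Fin n → Q)) m := by
  induction n with
  | zero => exact hpd_of_subsingleton _ _
  | succ n ih =>
    obtain ⟨w, hs⟩ := ses (X := Q) (Y := ModuleCat.of A (Fin (n + 1) → Q))
      (Z := ModuleCat.of A (Fin n → Q)) (LinearMap.single A (fun _ => Q) 0)
      (LinearMap.funLeft A Q Fin.succ) (Pi.single_injective (M := fun _ => Q) 0)
      (LinearMap.funLeft_surjective_of_injective _ _ _ (Fin.succ_injective n)) (by
        intro x
        constructor
        · intro hx
          refine ⟨x 0, ?_⟩
          funext i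
          refine Fin.cases ?_ (fun j => ?_) i
          · simp
          · have : x j.succ = 0 := congrFun hx j
            simpa [LinearMap.funLeft, eq_comm] using this
        · rintro ⟨q, rfl⟩
          funext j
          change (Pi.single 0 q : Fin (n + 1) → Q) j.succ = 0
          simp)
    exact hs.hasProjectiveDimensionLT_X₂ m h ih

lemma hpd_add (Q X : ModuleCat.{0} A) (m : ℕ) (h : HasProjectiveDimensionLT Q m)
    (hX : InAdd A Q X) : HasProjectiveDimensionLT X m := by
  obtain ⟨n, s, r, hrs⟩ := hX
  have := hpd_fin Q m h n
  have e : Retract X (ModuleCat.of A (Fin n → Q)) :=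
    { i := ModuleCat.ofHom s
      r := ModuleCat.ofHom r
      retract := by
        ext x
        exact LinearMap.congr_fun hrs x }
  exact e.hasProjectiveDimensionLT m

/-- The kernel of the augmentation, as the next syzygy. -/
abbrev kerMod {X Y : ModuleCat.{0} A} (f : X →ₗ[A] Y) : ModuleCat.{0} A :=
  ModuleCat.of A (LinearMap.ker f)

lemma ses_ker {X Y : ModuleCat.{0} A} (f : X →ₗ[A] Y) (hf : Function.Surjective f) :
    ∃ w, (ShortComplex.mk (ModuleCat.ofHom (LinearMap.ker f).subtype : kerMod f ⟶ X)
      (ModuleCat.ofHom f) w).ShortExact :=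
  ses (X := kerMod f) (LinearMap.ker f).subtype f Subtype.val_injective hf
    (LinearMap.exact_subtype_ker_map f)

/-- The differential onto the kernel of the augmentation. -/
def aug' {X Y Z : ModuleCat.{0} A} (f : X →ₗ[A] Y) (g : Y →ₗ[A] Z) (h : Function.Exact f g) :
    X →ₗ[A] kerMod g :=
  f.codRestrict (LinearMap.ker g) (fun x => h.apply_apply_eq_zero x)

lemma aug'_surj {X Y Z : ModuleCat.{0} A} (f : X →ₗ[A] Y) (g : Y →ₗ[A] Z)
    (h : Function.Exact f g) : Function.Surjective (aug' f g h) := by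
  rintro ⟨y, hy⟩
  obtain ⟨x, rfl⟩ := (h y).1 hy
  exact ⟨x, rfl⟩

lemma aug'_exact {W X Y Z : ModuleCat.{0} A} (e : W →ₗ[A] X) (f : X →ₗ[A] Y) (g : Y →ₗ[A] Z)
    (h : Function.Exact f g) (h' : Function.Exact e f) : Function.Exact e (aug' f g h) := by
  intro x
  rw [← h' x]
  exact Subtype.ext_iff

lemma hpd_of_pdLE (m : ℕ) : ∀ X : ModuleCat.{0} A, pdLE A X m →
    HasProjectiveDimensionLT X (m + 1) := by
  induction m with
  | zero =>
    rintro X ⟨P, d, aug, hT, hz, hs, h0, -⟩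
    have := hz 1 (by omega)
    obtain ⟨w, h⟩ := ses (d 0) aug (Function.injective_of_subsingleton _) hs h0
    exact h.hasProjectiveDimensionLT_X₃ 0 (hpd_of_subsingleton _ _) (hpd_one _ (hT 0 le_rfl) 0)
  | succ m ih =>
    rintro X ⟨P, d, aug, hT, hz, hs, h0, hd, -, -, h3⟩
    obtain ⟨w, h⟩ := ses_ker aug hs
    refine h.hasProjectiveDimensionLT_X₃ (m + 1) (ih _ ?_) (hpd_one _ (hT 0 (by omega)) _)
    refine ⟨fun j => P (j + 1), fun j => d (j + 1), aug' (d 0) aug h0,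
      fun j hj => hT _ (by omega), fun j hj => hz _ (by omega), aug'_surj _ _ _,
      aug'_exact _ _ _ _ (hd 0), fun j => hd (j + 1), ?_, ?_, fun j => h3 (j + 1)⟩
    · intro f
      refine ⟨0, ?_⟩
      ext x
      obtain rfl : x = 0 := Subsingleton.elim (α := PUnit) _ _
      simp
    · intro f _
      refine ⟨0, ?_⟩
      ext x
      obtain rfl : x = 0 := Subsingleton.elim (α := PUnit) _ _
      simp

/-- Resolutions without the (vacuous) test conditions. -/
lemma pdLE_mk (X : ModuleCat.{0} A) (m : ℕ) (P : ℕ → ModuleCat.{0} A)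
    (d : ∀ j, P (j+1) →ₗ[A] P j) (aug : P 0 →ₗ[A] X)
    (hT : ∀ j, j ≤ m → Module.Projective A (P j)) (hz : ∀ j, m < j → Subsingleton (P j))
    (hs : Function.Surjective aug) (h0 : Function.Exact (d 0) aug)
    (hd : ∀ j, Function.Exact (d (j+1)) (d j)) : pdLE A X m := by
  have key : ∀ (Y : ModuleCat.{0} A) (f g : zeroMod A →ₗ[A] Y), f = g := by
    intro Y f g
    ext x
    obtain rfl : x = 0 := Subsingleton.elim (α := PUnit) _ _
    simp
  exact ⟨P, d, aug, hT, hz, hs, h0, hd, fun f => ⟨0, key _ _ _⟩, fun f _ => ⟨0, key _ _ _⟩,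
    fun j f _ => ⟨0, key _ _ _⟩⟩

lemma pdLE_of_hpd (m : ℕ) : ∀ X : ModuleCat.{0} A, HasProjectiveDimensionLT X (m + 1) →
    pdLE A X m := by
  induction m with
  | zero =>
    intro X hX
    have hp : Module.Projective A X :=
      (IsProjective.iff_projective X).2 (projective_iff_hasProjectiveDimensionLT_one.2 hX)
    refine pdLE_mk X 0 (fun j => Nat.casesOn j X (fun _ => zeroMod A)) (fun j => 0)
      LinearMap.id ?_ ?_ Function.surjective_id ?_ ?_
    · rintro (_ | j) hj
      · exact hp
      · omega
    · rintro (_ | j) hj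
      · omega
      · exact inferInstanceAs (Subsingleton PUnit)
    · intro x
      constructor
      · intro hx
        exact ⟨0, Eq.symm hx⟩
      · rintro ⟨y, rfl⟩
        rfl
    · intro j x
      constructor
      · intro _
        exact ⟨0, Subsingleton.elim (α := PUnit) _ _⟩
      · intro _
        rfl
  | succ m ih =>
    intro X hX
    let F : ModuleCat.{0} A := ModuleCat.of A (X →₀ A)
    let p : F →ₗ[A] X := Finsupp.linearCombination A id
    have hp : Function.Surjective p := Finsupp.linearCombination_id_surjective A X
    have hF : Module.Projective A F := inferInstanceAs (Module.Projective A (X →₀ A))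
    obtain ⟨w, h⟩ := ses_ker p hp
    have hK := h.hasProjectiveDimensionLT_X₁ (m + 1) (hpd_one _ hF _) hX
    obtain ⟨P, d, aug, hT, hz, hs, h0, hd, -⟩ := ih _ hK
    refine pdLE_mk X (m + 1) (fun j => Nat.casesOn j F P)
      (fun j => match j with
        | 0 => (LinearMap.ker p).subtype ∘ₗ aug
        | j + 1 => d j) p ?_ ?_ hp ?_ ?_
    · rintro (_ | j) hj
      · exact hF
      · exact hT j (by omega)
    · rintro (_ | j) hj
      · omega
      · exact hz j (by omega)
    · intro x
      constructor
      · intro hx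
        obtain ⟨y, hy⟩ := hs ⟨x, hx⟩
        exact ⟨y, congrArg Subtype.val hy⟩
      · rintro ⟨y, rfl⟩
        exact (aug y).2
    · rintro (_ | j)
      · intro x
        refine Iff.trans ?_ (h0 x)
        exact (Subtype.ext_iff (a1 := aug x) (a2 := 0)).symm
      · exact hd j

lemma main (l m : ℕ) : ∀ (X : ModuleCat.{0} A) (P : ℕ → ModuleCat.{0} A)
    (d : ∀ j, P (j+1) →ₗ[A] P j) (aug : P 0 →ₗ[A] X),
    (∀ j, j ≤ m → HasProjectiveDimensionLT (P j) (l + 1)) → Subsingleton (P (m + 2)) →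
    Function.Surjective aug → Function.Exact (d 0) aug →
    (∀ j, Function.Exact (d (j+1)) (d j)) → HasProjectiveDimensionLT X (l + m + 1 + 1) →
    HasProjectiveDimensionLT (P (m + 1)) (l + 1) := by
  induction m with
  | zero =>
    intro X P d aug hP hz hs h0 hd hX
    have hinj : Function.Injective (d 0) := by
      rw [injective_iff_map_eq_zero]
      intro x hx
      obtain ⟨y, rfl⟩ := (hd 0 x).1 hx
      rw [Subsingleton.elim (α := P (0 + 2)) y 0, map_zero]
    obtain ⟨w, h⟩ := ses (d 0) aug hinj hs h0
    exact h.hasProjectiveDimensionLT_X₁ (l + 1) (hP 0 le_rfl) hX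
  | succ m ih =>
    intro X P d aug hP hz hs h0 hd hX
    obtain ⟨w, h⟩ := ses_ker aug hs
    have h2 := hP 0 (by omega)
    have hK := h.hasProjectiveDimensionLT_X₁ (l + m + 1 + 1)
      (hasProjectiveDimensionLT_of_ge _ (l + 1) _ (by omega)) hX
    exact ih _ (fun j => P (j + 1)) (fun j => d (j + 1)) (aug' (d 0) aug h0)
      (fun j hj => hP _ (by omega)) hz (aug'_surj _ _ _) (aug'_exact _ _ _ _ (hd 0))
      (fun j => hd (j + 1)) hK

end PdAux

noncomputable section Statement0
open Paper

/-- Lemma 2.6: Given an exact sequence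
`0 → X_{n-l} → Q_{n-l-1} → ⋯ → Q_0 → X_0 → 0` of finitely generated left `A`-modules with
all middle terms in `add Q`, if `pd X_0 ≤ n` and `pd Q = l` with `n > l`, then
`pd X_{n-l} ≤ l`.  (Here `X_{n-l}` is the term `P (n-l)` of the chain.) -/
theorem stmt0 (k : Type) [Field k] (A : Type) [Ring A] [Algebra k A] [FiniteDimensional k A]
    (Q : ModuleCat.{0} A) [Module.Finite A Q]
    (n l : ℕ) (hln : l < n)
    (P : ℕ → ModuleCat.{0} A) (d : ∀ j, P (j+1) →ₗ[A] P j)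
    (X0 : ModuleCat.{0} A) [Module.Finite A X0]
    (hfin : ∀ j, Module.Finite A (P j))
    (aug : P 0 →ₗ[A] X0)
    (hmem : ∀ j, j ≤ n - l - 1 → InAdd A Q (P j))
    (hzero : ∀ j, n - l < j → Subsingleton (P j))
    (hsurj : Function.Surjective aug)
    (hex0 : Function.Exact (d 0) aug)
    (hex : ∀ j, Function.Exact (d (j+1)) (d j))
    (hpdX : pdLE A X0 n) (hpdQ : pdEq A Q l) :
    pdLE A (P (n - l)) l := by
  have hQ := PdAux.hpd_of_pdLE l Q hpdQ.1
  obtain ⟨m, rfl⟩ : ∃ m, n = l + m + 1 := ⟨n - l - 1, by omega⟩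
  have e : l + m + 1 - l = m + 1 := by omega
  rw [e] at hmem hzero ⊢
  exact PdAux.pdLE_of_hpd l _ (PdAux.main l m X0 P d aug
    (fun j hj => PdAux.hpd_add Q _ _ hQ (hmem j (by omega))) (hzero _ (by omega))
    hsurj hex0 hex (PdAux.hpd_of_pdLE _ X0 hpdX))

end Statement0
end

section
/- Let A be a finite-dimensional k-algebra, Q and X finitely generated left A-modules with Q-domdim_A(A) ≥ 2, and Λ = End_A(Q)^op. If Ext^i_A(Q, X) = 0 for all i > 0 and Q-codomdim_A(X) ≥ 2, then the injective dimension of X over A equals the relative add(Q_Λ)-dimension of the right Λ-module D Hom_A(Q, X), i.e., the minimal length of an exact sequence 0 → Q'_m → ⋯ → Q'_0 → D Hom_A(Q, X) → 0 with Q'_i ∈ add(Q_Λ) which remains exact under Hom_Λ(Q, −). -/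
universe u
open MulOpposite

noncomputable section Helpers
namespace Paper
namespace Aux
open CategoryTheory

section Res
variable {B : Type} [Ring B]

theorem res_cons {test : ModuleCat.{0} B} {T : ModuleCat.{0} B → Prop} {X P K : ModuleCat.{0} B}
    {m : ℕ} (i : K →ₗ[B] P) (p : P →ₗ[B] X) (hi : Function.Injective i)
    (hp : Function.Surjective p) (hex : Function.Exact i p) (hT : T P)
    (hl : ∀ f : test →ₗ[B] X, ∃ h : test →ₗ[B] P, p ∘ₗ h = f)
    (h : ResLE B test T K m) : ResLE B test T X (m + 1) := by
  obtain ⟨P', d, aug, h1, h2, h3, h4, h5, h6, h7, h8⟩ := h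
  refine ⟨fun j => Nat.casesOn j P P', fun j => match j with
    | 0 => i ∘ₗ aug
    | (j+1) => d j, p, ?_, ?_, hp, ?_, ?_, hl, ?_, ?_⟩
  · rintro (_ | j) hj
    · exact hT
    · exact h1 j (by omega)
  · rintro (_ | j) hj
    · omega
    · exact h2 j (by omega)
  · intro y
    rw [hex y]
    constructor
    · rintro ⟨z, rfl⟩
      obtain ⟨w, rfl⟩ := h3 z
      exact ⟨w, rfl⟩
    · rintro ⟨w, rfl⟩
      exact ⟨aug w, rfl⟩
  · rintro (_ | j)
    · intro y
      rw [← h4 y]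
      constructor
      · intro hy
        exact hi (by rw [map_zero]; exact hy)
      · intro hy
        change i (aug y) = 0
        rw [hy, map_zero]
    · exact h5 j
  · intro f hf
    have hk : ∀ t, ∃ z, i z = f t := fun t => (hex (f t)).1 (LinearMap.congr_fun hf t)
    choose g hg using hk
    let g' : test →ₗ[B] K :=
      { toFun := g
        map_add' := fun a b => hi (by simp [hg])
        map_smul' := fun a b => hi (by simp [hg]) }
    obtain ⟨u, hu⟩ := h6 g'
    refine ⟨u, ?_⟩
    ext t
    have := LinearMap.congr_fun hu t
    change i (aug (u t)) = f t
    rw [← hg t]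
    exact congrArg i this
  · rintro (_ | j) f hf
    · apply h7 f
      ext t
      exact hi (by rw [LinearMap.zero_apply, map_zero]; exact LinearMap.congr_fun hf t)
    · exact h8 j f hf

theorem res_uncons {test : ModuleCat.{0} B} {T : ModuleCat.{0} B → Prop} {X : ModuleCat.{0} B}
    {m : ℕ} (h : ResLE B test T X (m + 1)) :
    ∃ (P : ModuleCat.{0} B) (p : P →ₗ[B] X), T P ∧ Function.Surjective p ∧
      (∀ f : test →ₗ[B] X, ∃ h : test →ₗ[B] P, p ∘ₗ h = f) ∧
      ResLE B test T (ModuleCat.of B (LinearMap.ker p)) m := by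
  obtain ⟨P, d, aug, h1, h2, h3, h4, h5, h6, h7, h8⟩ := h
  refine ⟨P 0, aug, h1 0 (by omega), h3, h6, fun j => P (j+1), fun j => d (j+1),
    (d 0).codRestrict (LinearMap.ker aug) (fun x => (h4 _).2 ⟨x, rfl⟩), ?_, ?_, ?_, ?_, ?_, ?_, ?_, ?_⟩
  · intro j hj; exact h1 _ (by omega)
  · intro j hj; exact h2 _ (by omega)
  · rintro ⟨y, hy⟩
    obtain ⟨z, hz⟩ := (h4 y).1 hy
    exact ⟨z, Subtype.ext hz⟩
  · intro y
    rw [← h5 0 y]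
    exact Subtype.ext_iff
  · intro j; exact h5 _
  · intro f
    obtain ⟨u, hu⟩ := h7 ((LinearMap.ker aug).subtype ∘ₗ f) (by
      ext t; exact (f t).2)
    refine ⟨u, ?_⟩
    ext t
    exact LinearMap.congr_fun hu t
  · intro f hf
    apply h8 0 f
    ext t
    exact congrArg Subtype.val (LinearMap.congr_fun hf t)
  · intro j f hf; exact h8 (j+1) f hf

theorem res_zero {test : ModuleCat.{0} B} {T : ModuleCat.{0} B → Prop} {X : ModuleCat.{0} B}
    (h : T X) : ResLE B test T X 0 := by
  refine ⟨fun j => Nat.casesOn j X (fun _ => zeroMod B), fun j => match j with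
    | 0 => 0
    | (j+1) => 0, LinearMap.id, ?_, ?_, Function.surjective_id, ?_, ?_, ?_, ?_, ?_⟩
  · intro j hj
    obtain rfl : j = 0 := by omega
    exact h
  · rintro (_ | j) hj
    · omega
    · exact inferInstanceAs (Subsingleton PUnit)
  · intro y
    constructor
    · intro hy; exact ⟨0, by simpa using hy.symm⟩
    · rintro ⟨w, rfl⟩; rfl
  · intro j y
    constructor
    · intro hy; exact ⟨0, Subsingleton.elim (α := PUnit) _ _⟩
    · rintro ⟨w, rfl⟩; cases j <;> rfl
  · intro f; exact ⟨f, rfl⟩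
  · intro f hf; exact ⟨0, by rw [LinearMap.comp_zero]; exact hf.symm⟩
  · intro j f hf; exact ⟨0, LinearMap.ext fun t => Subsingleton.elim (α := PUnit) _ _⟩

theorem res_zero' {test : ModuleCat.{0} B} {T : ModuleCat.{0} B → Prop} {X : ModuleCat.{0} B}
    (h : ResLE B test T X 0) : ∃ P, T P ∧ Nonempty (P ≃ₗ[B] X) := by
  obtain ⟨P, d, aug, h1, h2, h3, h4, -⟩ := h
  refine ⟨P 0, h1 0 le_rfl, ⟨LinearEquiv.ofBijective aug ⟨?_, h3⟩⟩⟩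
  rw [injective_iff_map_eq_zero]
  intro a ha
  obtain ⟨w, rfl⟩ := (h4 a).1 ha
  haveI := h2 1 (by omega)
  rw [Subsingleton.elim w 0, map_zero]

theorem inj_of_equiv {M N : Type} [AddCommGroup M] [Module B M] [AddCommGroup N] [Module B N]
    (s : M →ₗ[B] N) (r : N →ₗ[B] M) (hrs : ∀ x, r (s x) = x) (h : Module.Injective B N) :
    Module.Injective B M := by
  refine ⟨fun X Y _ _ _ _ f hf g => ?_⟩
  obtain ⟨u, hu⟩ := h.out f hf (s ∘ₗ g)
  exact ⟨r ∘ₗ u, fun x => by simp [hu, hrs]⟩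

theorem injDim_ses {X I C : ModuleCat.{0} B} (i : X →ₗ[B] I) (p : I →ₗ[B] C)
    (hi : Function.Injective i) (hp : Function.Surjective p) (hex : Function.Exact i p)
    (hI : Module.Injective B I) (m : ℕ) :
    HasInjectiveDimensionLT C (m + 1) ↔ HasInjectiveDimensionLT X (m + 2) := by
  let S : ShortComplex (ModuleCat.{0} B) :=
    ShortComplex.mk (ModuleCat.ofHom i) (ModuleCat.ofHom p) (by
      ext x; exact (hex _).2 ⟨x, rfl⟩)
  have hS : S.ShortExact := ModuleCat.shortComplex_shortExact S hex hi hp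
  exact hS.hasInjectiveDimensionLT_X₃_iff m ((Module.injective_iff_injective_object B I).1 hI)

theorem injDim_zero {X : ModuleCat.{0} B} : Module.Injective B X ↔ HasInjectiveDimensionLT X 1 := by
  rw [← injective_iff_hasInjectiveDimensionLT_one]
  exact Module.injective_iff_injective_object B X

theorem idLE_imp (m : ℕ) : ∀ X : ModuleCat.{0} B, idLE B X m → HasInjectiveDimensionLT X (m + 1) := by
  induction m with
  | zero =>
    rintro X ⟨M, ι, d, h1, h2, h3, h4, -⟩
    rw [← injDim_zero]
    have hs : Function.Surjective ι := fun y => (h4 y).1 (by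
      haveI := h2 1 (by omega)
      exact Subsingleton.elim _ _)
    let e := LinearEquiv.ofBijective ι ⟨h3, hs⟩
    exact inj_of_equiv e.toLinearMap e.symm.toLinearMap (fun x => e.symm_apply_apply x) (h1 0 le_rfl)
  | succ m ih =>
    rintro X ⟨M, ι, d, h1, h2, h3, h4, h5, -⟩
    have hle : LinearMap.range ι ≤ LinearMap.ker (d 0) := by
      rintro _ ⟨x, rfl⟩; exact (h4 _).2 ⟨x, rfl⟩
    rw [← injDim_ses (X := X) (C := ModuleCat.of B (M 0 ⧸ LinearMap.range ι)) ι
      (LinearMap.range ι).mkQ h3 (Submodule.mkQ_surjective _)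
      (LinearMap.exact_map_mkQ_range ι) (h1 0 (by omega)) m]
    apply ih
    refine ⟨fun j => M (j+1), (LinearMap.range ι).liftQ (d 0) hle, fun j => d (j+1),
      ?_, ?_, ?_, ?_, ?_, ?_, ?_, ?_⟩
    · intro j hj; exact h1 _ (by omega)
    · intro j hj; exact h2 _ (by omega)
    · rw [← LinearMap.ker_eq_bot]
      apply Submodule.ker_liftQ_eq_bot
      intro y hy; exact (h4 y).1 hy
    · intro y
      refine (h5 0 y).trans ?_
      constructor
      · rintro ⟨w, rfl⟩; exact ⟨Submodule.Quotient.mk w, rfl⟩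
      · rintro ⟨w, rfl⟩
        obtain ⟨w, rfl⟩ := Submodule.Quotient.mk_surjective _ w
        exact ⟨w, rfl⟩
    · intro j; exact h5 _
    all_goals
      intros
      exact ⟨0, LinearMap.ext fun _ => Subsingleton.elim (α := PUnit) _ _⟩

theorem idLE_of (m : ℕ) : ∀ X : ModuleCat.{0} B, HasInjectiveDimensionLT X (m + 1) → idLE B X m := by
  induction m with
  | zero =>
    intro X hX
    rw [zero_add, ← injDim_zero] at hX
    refine ⟨fun j => Nat.casesOn j X (fun _ => zeroMod B), LinearMap.id, fun j => 0,
      ?_, ?_, Function.injective_id, ?_, ?_, ?_, ?_, ?_⟩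
    · intro j hj
      obtain rfl : j = 0 := by omega
      exact hX
    · rintro (_ | j) hj
      · omega
      · exact inferInstanceAs (Subsingleton PUnit)
    · intro y
      exact ⟨fun _ => ⟨y, rfl⟩, fun _ => rfl⟩
    · intro j y
      exact ⟨fun _ => ⟨0, Subsingleton.elim (α := PUnit) _ _⟩, fun _ => rfl⟩
    all_goals
      intros
      exact ⟨0, LinearMap.ext fun _ => Subsingleton.elim (α := PUnit) _ _⟩
  | succ m ih =>
    intro X hX
    let J : ModuleCat.{0} B := Injective.under X
    let ι : X →ₗ[B] J := (Injective.ι X).hom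
    have hι : Function.Injective ι := (ModuleCat.mono_iff_injective (Injective.ι X)).1 inferInstance
    have hJ : Module.Injective B J := (Module.injective_iff_injective_object B J).2
      (inferInstanceAs (Injective (Injective.under X)))
    have hC := ih _ ((injDim_ses (X := X) (C := ModuleCat.of B (J ⧸ LinearMap.range ι)) ι
      (LinearMap.range ι).mkQ hι (Submodule.mkQ_surjective _)
      (LinearMap.exact_map_mkQ_range ι) hJ m).2 hX)
    obtain ⟨M, κ, d, h1, h2, h3, h4, h5, -⟩ := hC
    refine ⟨fun j => Nat.casesOn j J M, ι, fun j => match j with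
      | 0 => κ ∘ₗ (LinearMap.range ι).mkQ
      | (j+1) => d j, ?_, ?_, hι, ?_, ?_, ?_, ?_, ?_⟩
    · rintro (_ | j) hj
      · exact hJ
      · exact h1 j (by omega)
    · rintro (_ | j) hj
      · omega
      · exact h2 j (by omega)
    · intro y
      rw [← LinearMap.exact_map_mkQ_range ι y]
      constructor
      · intro hy; exact h3 (by rw [map_zero]; exact hy)
      · intro hy
        change κ ((LinearMap.range ι).mkQ y) = 0
        rw [hy, map_zero]
    · rintro (_ | j)
      · intro y
        refine (h4 y).trans ?_
        constructor
        · rintro ⟨w, rfl⟩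
          obtain ⟨w, rfl⟩ := Submodule.Quotient.mk_surjective _ w
          exact ⟨w, rfl⟩
        · rintro ⟨w, rfl⟩; exact ⟨Submodule.Quotient.mk w, rfl⟩
      · exact h5 j
    all_goals
      intros
      exact ⟨0, LinearMap.ext fun _ => Subsingleton.elim (α := PUnit) _ _⟩

end Res
end Aux
end Paper
end Helpers

noncomputable section Helpers2
namespace Paper
namespace Aux
open CategoryTheory

section ExtPart
variable {A : Type} [Ring A]

/-- iterated syzygies of `Q` along free covers -/
def syz (Q : ModuleCat.{0} A) : ℕ → ModuleCat.{0} A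
  | 0 => Q
  | (j+1) => ModuleCat.of A (LinearMap.ker (Finsupp.linearCombination A (id : syz Q j → syz Q j)))

/-- the free resolution -/
def freeRes (Q : ModuleCat.{0} A) : ProjRes A Q where
  P j := ModuleCat.of A (syz Q j →₀ A)
  d j := (LinearMap.ker (Finsupp.linearCombination A (id : syz Q j → syz Q j))).subtype ∘ₗ
    (Finsupp.linearCombination A (id : syz Q (j+1) → syz Q (j+1)))
  aug := Finsupp.linearCombination A (id : syz Q 0 → syz Q 0)
  proj j := inferInstance
  augSurj := Finsupp.linearCombination_id_surjective A _
  exact0 := by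
    intro y
    constructor
    · intro hy
      obtain ⟨w, hw⟩ := Finsupp.linearCombination_id_surjective A (syz Q 1) ⟨y, hy⟩
      exact ⟨w, congrArg Subtype.val hw⟩
    · rintro ⟨w, rfl⟩
      exact (Finsupp.linearCombination A (id : syz Q 1 → syz Q 1) w).2
  exact j := by
    intro y
    constructor
    · intro hy
      obtain ⟨w, hw⟩ := Finsupp.linearCombination_id_surjective A (syz Q (j+2))
        ⟨y, Subtype.ext hy⟩
      exact ⟨w, congrArg Subtype.val hw⟩
    · rintro ⟨w, rfl⟩
      exact congrArg Subtype.val (Finsupp.linearCombination A (id : syz Q (j+2) → syz Q (j+2)) w).2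

theorem lift_ker {M N P : Type} [AddCommGroup M] [Module A M] [AddCommGroup N] [Module A N]
    [AddCommGroup P] [Module A P] (i : M →ₗ[A] N) (hi : Function.Injective i) (f : P →ₗ[A] N)
    (h : ∀ x, ∃ z, i z = f x) : ∃ g : P →ₗ[A] M, ∀ x, i (g x) = f x := by
  choose g hg using h
  exact ⟨{ toFun := g
           map_add' := fun a b => hi (by simp [hg])
           map_smul' := fun a b => hi (by simp [hg]) }, hg⟩

theorem desc_surj {M N P : Type} [AddCommGroup M] [Module A M] [AddCommGroup N] [Module A N]
    [AddCommGroup P] [Module A P] (p : M →ₗ[A] N) (hp : Function.Surjective p) (f : M →ₗ[A] P)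
    (h : ∀ x, p x = 0 → f x = 0) : ∃ g : N →ₗ[A] P, ∀ x, g (p x) = f x := by
  have hfac : ∀ x y, p x = p y → f x = f y := by
    intro x y hxy
    have := h (x - y) (by rw [map_sub, hxy, sub_self])
    rw [map_sub, sub_eq_zero] at this
    exact this
  choose s hs using hp
  refine ⟨{ toFun := fun n => f (s n)
            map_add' := fun a b => ?_
            map_smul' := fun a b => ?_ }, fun x => hfac _ _ (hs _)⟩
  · rw [← map_add]; apply hfac; simp [hs]
  · rw [RingHom.id_apply, ← map_smul]; apply hfac; simp [hs]

variable {Q X I C : ModuleCat.{0} A} (i : X →ₗ[A] I) (p : I →ₗ[A] C)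

theorem ext_lift (hi : Function.Injective i) (hp : Function.Surjective p)
    (hex : Function.Exact i p) (h : ExtVanish A Q X 1) (f : Q →ₗ[A] C) : ∃ g : Q →ₗ[A] I, p ∘ₗ g = f := by
  let R := freeRes Q
  haveI := R.proj
  obtain ⟨f', hf'⟩ := Module.projective_lifting_property p (f ∘ₗ R.aug) hp
  have hf'' : ∀ x, p (f' x) = f (R.aug x) := fun x => LinearMap.congr_fun hf' x
  obtain ⟨g, hg⟩ := lift_ker i hi (f' ∘ₗ R.d 0) (fun x => (hex _).1 (by
    rw [LinearMap.comp_apply, hf'', (R.exact0 _).2 ⟨x, rfl⟩, map_zero]))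
  obtain ⟨h', hh'⟩ := h R g (by
    ext x
    apply hi
    simp only [LinearMap.comp_apply, LinearMap.zero_apply, map_zero, hg]
    rw [(R.exact 0 _).2 ⟨x, rfl⟩, map_zero])
  obtain ⟨l, hl⟩ := desc_surj R.aug R.augSurj (f' - i ∘ₗ h') (by
    intro x hx
    obtain ⟨w, rfl⟩ := (R.exact0 _).1 hx
    have h1 := hg w
    rw [hh'] at h1
    simp only [LinearMap.comp_apply] at h1
    simp [h1])
  refine ⟨l, ?_⟩
  ext x
  obtain ⟨y, rfl⟩ := R.augSurj x
  simp only [LinearMap.comp_apply, hl, LinearMap.sub_apply, map_sub, hf'']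
  rw [(hex (i (h' y))).2 ⟨_, rfl⟩, sub_zero]

theorem ext_shift (hi : Function.Injective i) (hp : Function.Surjective p)
    (hex : Function.Exact i p) (hI : Module.Injective A I) (n : ℕ) (h : ExtVanish A Q X (n + 2)) :
    ExtVanish A Q C (n + 1) := by
  intro R f hf
  haveI := R.proj
  obtain ⟨f', hf'⟩ := Module.projective_lifting_property p f hp
  have hf'' : ∀ x, p (f' x) = f x := fun x => LinearMap.congr_fun hf' x
  obtain ⟨g, hg⟩ := lift_ker i hi (f' ∘ₗ R.d (n+1)) (fun x => (hex _).1 (by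
    rw [LinearMap.comp_apply, hf'']; exact LinearMap.congr_fun hf x))
  obtain ⟨h', hh'⟩ := h R g (by
    ext x
    apply hi
    simp only [LinearMap.comp_apply, LinearMap.zero_apply, map_zero, hg]
    rw [(R.exact (n+1) _).2 ⟨x, rfl⟩, map_zero])
  obtain ⟨l, hl⟩ := desc_surj (R.d n).rangeRestrict (R.d n).surjective_rangeRestrict
    (f' - i ∘ₗ h') (by
    intro x hx
    obtain ⟨w, rfl⟩ := (R.exact n _).1 (congrArg Subtype.val hx)
    have h1 := hg w
    rw [hh'] at h1
    simp only [LinearMap.comp_apply] at h1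
    simp [h1])
  obtain ⟨u, hu⟩ := hI.out (LinearMap.range (R.d n)).subtype (Submodule.injective_subtype _) l
  refine ⟨p ∘ₗ u, ?_⟩
  ext x
  have h2 := hu ((R.d n).rangeRestrict x)
  rw [hl] at h2
  have h3 : u (R.d n x) = (f' - i ∘ₗ h') x := h2
  simp only [LinearMap.comp_apply, h3, LinearMap.sub_apply, map_sub, hf'']
  rw [(hex (i (h' x))).2 ⟨_, rfl⟩, sub_zero]

end ExtPart
end Aux
end Paper
end Helpers2

noncomputable section Helpers3
namespace Paper
namespace Aux
open CategoryTheory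

section Functor
variable (k : Type) [Field k] {A : Type} [Ring A] [Algebra k A] (Q : ModuleCat.{0} A)

/-- `Hom_A(Q, Y)` as a right `End_A(Q)`-module. -/
def HH (Y : ModuleCat.{0} A) : ModuleCat.{0} (Module.End A Q)ᵐᵒᵖ :=
  ModuleCat.of (Module.End A Q)ᵐᵒᵖ (Q →ₗ[A] Y)

/-- `D Hom_A(Q, Y)` as a left `End_A(Q)`-module. -/
abbrev FF (Y : ModuleCat.{0} A) : ModuleCat.{0} (Module.End A Q) :=
  Dunop k (Module.End A Q) (ModuleCat.of (Module.End A Q)ᵐᵒᵖ (Q →ₗ[A] Y))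

variable {k Q}

/-- evaluation of an element of `D Hom_A(Q, Y)` -/
def ev {Y : ModuleCat.{0} A} (w : FF k Q Y) (f : Q →ₗ[A] Y) : k :=
  (show HH Q Y →ₗ[k] k from w) f

theorem kmod_smul_eq (Y : ModuleCat.{0} A) (c : k)
    (f : HH Q Y) (q : Q) :
    (show Q →ₗ[A] Y from (kmod k (Module.End A Q)ᵐᵒᵖ _).smul c f) q
      = c • ((show Q →ₗ[A] Y from f) q) := by
  change (show Q →ₗ[A] Y from f) (algebraMap k (Module.End A Q) c q) = _
  rw [Module.algebraMap_end_apply]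
  exact LinearMap.map_smul_of_tower (show Q →ₗ[A] Y from f) c q

theorem ev_ext {Y : ModuleCat.{0} A} {w w' : FF k Q Y} (h : ∀ f, ev w f = ev w' f) : w = w' :=
  LinearMap.ext (σ := RingHom.id k) (M := HH Q Y) h

theorem ev_add {Y : ModuleCat.{0} A} (w : FF k Q Y) (f g : Q →ₗ[A] Y) :
    ev w (f + g) = ev w f + ev w g :=
  map_add (show HH Q Y →ₗ[k] k from w) _ _

theorem ev_zero {Y : ModuleCat.{0} A} (w : FF k Q Y) : ev w 0 = 0 :=
  map_zero (show HH Q Y →ₗ[k] k from w)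

theorem ev_smul {Y : ModuleCat.{0} A} (w : FF k Q Y) (c : k) (f : Q →ₗ[A] Y) :
    ev w (c • f) = c * ev w f := by
  have h := map_smul (show HH Q Y →ₗ[k] k from w) c (show HH Q Y from f)
  rw [smul_eq_mul] at h
  refine Eq.trans ?_ h
  unfold ev
  congr 1
  exact LinearMap.ext (σ := RingHom.id A) (M := Q) (M₃ := Y) fun q => (kmod_smul_eq Y c f q).symm

theorem ev_sum {Y : ModuleCat.{0} A} (w : FF k Q Y) {ι : Type} (s : Finset ι)
    (f : ι → (Q →ₗ[A] Y)) : ev w (∑ j ∈ s, f j) = ∑ j ∈ s, ev w (f j) :=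
  map_sum (show HH Q Y →ₗ[k] k from w) f s

theorem add_ev {Y : ModuleCat.{0} A} (w w' : FF k Q Y) (f : Q →ₗ[A] Y) :
    ev (w + w') f = ev w f + ev w' f := rfl

theorem zero_ev {Y : ModuleCat.{0} A} (f : Q →ₗ[A] Y) :
    ev (0 : FF k Q Y) f = 0 := rfl

theorem smul_ev {Y : ModuleCat.{0} A} (e : Module.End A Q) (w : FF k Q Y) (f : Q →ₗ[A] Y) :
    ev (e • w) f = ev w (f ∘ₗ e) := rfl

/-- constructor for elements of `D Hom_A(Q, Y)` -/
def mkF {Y : ModuleCat.{0} A} (w : (Q →ₗ[A] Y) → k) (h1 : ∀ f g, w (f + g) = w f + w g)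
    (h2 : ∀ (c : k) f, w (c • f) = c * w f) : FF k Q Y :=
  (show HH Q Y →ₗ[k] k from
  { toFun := w
    map_add' := h1
    map_smul' := by
      intro c f
      rw [RingHom.id_apply, smul_eq_mul]
      refine Eq.trans ?_ (h2 c f)
      congr 1
      ext q
      exact kmod_smul_eq Y c f q })

theorem ev_mkF {Y : ModuleCat.{0} A} (w : (Q →ₗ[A] Y) → k) (h1 : ∀ f g, w (f + g) = w f + w g)
    (h2 : ∀ (c : k) f, w (c • f) = c * w f) (f) : ev (mkF w h1 h2) f = w f := rfl

/-- functoriality of `D Hom_A(Q, -)` -/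
def Fmap {Y Z : ModuleCat.{0} A} (g : Y →ₗ[A] Z) : FF k Q Z →ₗ[Module.End A Q] FF k Q Y where
  toFun w := mkF (fun f => ev w (g ∘ₗ f)) (fun f f' => by rw [LinearMap.comp_add, ev_add])
    (fun c f => by
      rw [← ev_smul]; congr 1; ext q
      exact LinearMap.map_smul_of_tower g c (f q))
  map_add' w w' := ev_ext fun f => rfl
  map_smul' e w := ev_ext fun f => rfl

theorem ev_Fmap {Y Z : ModuleCat.{0} A} (g : Y →ₗ[A] Z) (w : FF k Q Z) (f) :
    ev (Fmap g w) f = ev w (g ∘ₗ f) := rfl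

variable (k Q)

/-- `DY → Hom_E(Q, FY)` is injective -/
def AInj (Y : ModuleCat.{0} A) : Prop :=
  ∀ φ : Y →ₗ[k] k, (∀ (f : Q →ₗ[A] Y) (q : Q), φ (f q) = 0) → φ = 0

/-- `DY → Hom_E(Q, FY)` is surjective -/
def ASurj (Y : ModuleCat.{0} A) : Prop :=
  ∀ u : Q →ₗ[Module.End A Q] FF k Q Y, ∃ φ : Y →ₗ[k] k, ∀ q f, ev (u q) f = φ (f q)

variable {k Q}

/-- the map `Q → FY` attached to a functional on `Y` -/
def alpha {Y : ModuleCat.{0} A} (φ : Y →ₗ[k] k) : Q →ₗ[Module.End A Q] FF k Q Y where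
  toFun q := mkF (fun f => φ (f q)) (fun f g => by simp) (fun c f => by simp)
  map_add' q q' := ev_ext fun f => by simp [add_ev, ev_mkF]
  map_smul' e q := ev_ext fun f => rfl

theorem ev_alpha {Y : ModuleCat.{0} A} (φ : Y →ₗ[k] k) (q : Q) (f : Q →ₗ[A] Y) :
    ev (alpha φ q) f = φ (f q) := rfl

section Ses
variable {X I C : ModuleCat.{0} A} (i : X →ₗ[A] I) (p : I →ₗ[A] C)

theorem Fmap_inj (hl : ∀ f : Q →ₗ[A] C, ∃ g : Q →ₗ[A] I, p ∘ₗ g = f) :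
    Function.Injective (Fmap (k := k) (Q := Q) p) := by
  intro w w' h
  apply ev_ext
  intro f
  obtain ⟨g, rfl⟩ := hl f
  rw [← ev_Fmap, h, ev_Fmap]

theorem Fmap_surj (hi : Function.Injective i) : Function.Surjective (Fmap (k := k) (Q := Q) i) := by
  intro w
  let c : (Q →ₗ[A] X) →ₗ[k] (Q →ₗ[A] I) :=
    { toFun := fun f => i ∘ₗ f
      map_add' := fun f g => by ext; simp
      map_smul' := fun a f => by ext q; exact LinearMap.map_smul_of_tower i a (f q) }
  have hc : Function.Injective c := by
    intro f g h
    ext q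
    exact hi (LinearMap.congr_fun h q)
  obtain ⟨r, hr⟩ := LinearMap.exists_leftInverse_of_injective c (LinearMap.ker_eq_bot.2 hc)
  refine ⟨mkF (fun f => ev w (r f)) (fun f g => by rw [map_add, ev_add])
    (fun a f => by rw [map_smul, ev_smul]), ?_⟩
  apply ev_ext
  intro f
  rw [ev_Fmap, ev_mkF]
  have := LinearMap.congr_fun hr f
  exact congrArg (ev w) this

theorem Fmap_exact (hi : Function.Injective i) (hex : Function.Exact i p) :
    Function.Exact (Fmap (k := k) (Q := Q) p) (Fmap (k := k) (Q := Q) i) := by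
  intro w
  constructor
  · intro hw
    -- extend along Hom(Q, I) → Hom(Q, C)
    let c : (Q →ₗ[A] I) →ₗ[k] (Q →ₗ[A] C) :=
      { toFun := fun f => p ∘ₗ f
        map_add' := fun f g => by ext; simp
        map_smul' := fun a f => by ext q; exact LinearMap.map_smul_of_tower p a (f q) }
    let w' : (Q →ₗ[A] I) →ₗ[k] k :=
      { toFun := fun f => ev w f
        map_add' := ev_add w
        map_smul' := ev_smul w }
    have hker : LinearMap.ker c ≤ LinearMap.ker w' := by
      intro f hf
      obtain ⟨g, hg⟩ := lift_ker i hi f (fun x => (hex _).1 (LinearMap.congr_fun hf x))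
      have : f = i ∘ₗ g := by ext x; exact (hg x).symm
      change ev w f = 0
      rw [this, ← ev_Fmap, hw, zero_ev]
    have : w' ∈ LinearMap.range c.dualMap := by
      rw [LinearMap.range_dualMap_eq_dualAnnihilator_ker, Submodule.mem_dualAnnihilator]
      exact fun f hf => hker hf
    obtain ⟨v, hv⟩ := this
    refine ⟨mkF (fun f => v f) (fun f g => map_add v f g) (fun a f => map_smul v a f), ?_⟩
    apply ev_ext
    intro f
    exact LinearMap.congr_fun hv f
  · rintro ⟨v, rfl⟩
    apply ev_ext
    intro f
    rw [ev_Fmap, ev_Fmap, zero_ev, ← LinearMap.comp_assoc]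
    have : p ∘ₗ i = 0 := by ext x; exact (hex _).2 ⟨x, rfl⟩
    rw [this, LinearMap.zero_comp, ev_zero]

theorem AInj_quot (hp : Function.Surjective p) (hI : AInj k Q I) : AInj k Q C := by
  intro φ hφ
  have := hI (φ ∘ₗ p.restrictScalars k) (fun f q => hφ (p ∘ₗ f) q)
  ext c
  obtain ⟨y, rfl⟩ := hp c
  exact LinearMap.congr_fun this y

theorem ASurj_quot (hp : Function.Surjective p) (hex : Function.Exact i p) (hI : ASurj k Q I) (hX : AInj k Q X)
    (hl : ∀ f : Q →ₗ[A] C, ∃ g : Q →ₗ[A] I, p ∘ₗ g = f) : ASurj k Q C := by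
  intro u
  obtain ⟨ψ, hψ⟩ := hI (Fmap p ∘ₗ u)
  have h0 : ψ ∘ₗ i.restrictScalars k = 0 := by
    apply hX
    intro f q
    have h1 := hψ q (i ∘ₗ f)
    rw [LinearMap.comp_apply, ev_Fmap, ← LinearMap.comp_assoc] at h1
    have : p ∘ₗ i = 0 := by ext x; exact (hex _).2 ⟨x, rfl⟩
    rw [this, LinearMap.zero_comp, ev_zero] at h1
    exact h1.symm
  obtain ⟨χ, hχ⟩ := desc_surj (p.restrictScalars k) hp ψ (by
    intro x hx
    obtain ⟨z, rfl⟩ := (hex x).1 hx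
    exact LinearMap.congr_fun h0 z)
  refine ⟨χ, fun q f => ?_⟩
  obtain ⟨g, rfl⟩ := hl f
  have h1 := hψ q g
  rw [LinearMap.comp_apply, ev_Fmap] at h1
  rw [h1, ← hχ]
  rfl

end Ses

/-- codominant dimension at least two gives bijectivity of `alpha` -/
theorem codom_AInj {X : ModuleCat.{0} A} (h : codomdimGE A Q X 2) : AInj k Q X ∧ ASurj k Q X := by
  obtain h | ⟨M, aug, d, h1, h2, h3, -, h5, h6, -⟩ := h
  · omega
  obtain ⟨n, s, r, hrs⟩ := h1 0 (by omega)
  obtain ⟨n1, s1, r1, hrs1⟩ := h1 1 (by omega)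
  have hex := h3 le_rfl
  have hrs' : ∀ x, r (s x) = x := fun x => LinearMap.congr_fun hrs x
  have hrs1' : ∀ x, r1 (s1 x) = x := fun x => LinearMap.congr_fun hrs1 x
  let p : (Fin n → Q) →ₗ[A] X := aug ∘ₗ r
  have hp : Function.Surjective p := by
    intro x
    obtain ⟨y, rfl⟩ := h2 x
    exact ⟨s y, by simp [p, hrs']⟩
  have hpl : ∀ f : Q →ₗ[A] X, ∃ g : Q →ₗ[A] (Fin n → Q), p ∘ₗ g = f := by
    intro f
    obtain ⟨g, rfl⟩ := h5 f
    exact ⟨s ∘ₗ g, by ext q; simp [p, hrs']⟩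
  let jn : Fin n → (Q →ₗ[A] (Fin n → Q)) := fun j => LinearMap.single A (fun _ => Q) j
  have hsum : ∀ z : Fin n → Q, z = ∑ j, jn j (z j) := fun z =>
    (LinearMap.sum_single_apply (fun _ : Fin n => (Q : Type)) z).symm
  constructor
  · intro φ hφ
    ext x
    obtain ⟨z, rfl⟩ := hp x
    rw [hsum z, map_sum, map_sum, LinearMap.zero_apply]
    exact Finset.sum_eq_zero fun j _ => hφ (p ∘ₗ jn j) (z j)
  · intro u
    let φn : (Fin n → Q) →ₗ[k] k :=
      { toFun := fun z => ∑ j, ev (u (z j)) (p ∘ₗ jn j)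
        map_add' := by
          intro z z'
          simp [add_ev, Finset.sum_add_distrib]
        map_smul' := by
          intro c z
          rw [RingHom.id_apply, smul_eq_mul, Finset.mul_sum]
          refine Finset.sum_congr rfl fun j _ => ?_
          have h1 : (c • z) j = (algebraMap k (Module.End A Q) c) • (z j) := by
            rw [Module.End.smul_def, Module.algebraMap_end_apply]; rfl
          rw [h1, map_smul, smul_ev, ← ev_smul]
          congr 1
          ext q
          rw [LinearMap.comp_apply, Module.algebraMap_end_apply]
          exact LinearMap.map_smul_of_tower (p ∘ₗ jn j) c q }
    have key : ∀ (g : Q →ₗ[A] (Fin n → Q)) (q : Q), φn (g q) = ev (u q) (p ∘ₗ g) := by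
      intro g q
      have h1 : p ∘ₗ g = ∑ j, (p ∘ₗ jn j) ∘ₗ (LinearMap.proj j ∘ₗ g) := by
        ext q'
        rw [LinearMap.sum_apply, LinearMap.comp_apply, hsum (g q'), map_sum]
        rfl
      rw [h1, ev_sum]
      change ∑ j, ev (u (g q j)) (p ∘ₗ jn j) = _
      refine Finset.sum_congr rfl fun j _ => ?_
      rw [← smul_ev (LinearMap.proj j ∘ₗ g : Module.End A Q), ← map_smul]
      rfl
    have hz : ∀ z, p.restrictScalars k z = 0 → φn z = 0 := by
      intro z hz
      have h1 : z = s (r z) + (z - s (r z)) := by abel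
      obtain ⟨y, hy⟩ := (hex (r z)).1 hz
      have h2 : φn (s (r z)) = 0 := by
        rw [← hy, ← hrs1' y]
        have : s1 y = ∑ j, LinearMap.single A (fun _ : Fin n1 => (Q : Type)) j (s1 y j) :=
          (LinearMap.sum_single_apply (fun _ : Fin n1 => (Q : Type)) _).symm
        rw [this]
        rw [map_sum, map_sum, map_sum, map_sum]
        refine Finset.sum_eq_zero fun j _ => ?_
        have h3 := key (s ∘ₗ d 0 ∘ₗ r1 ∘ₗ LinearMap.single A (fun _ : Fin n1 => (Q : Type)) j)
          (s1 y j)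
        have h4 : p ∘ₗ (s ∘ₗ d 0 ∘ₗ r1 ∘ₗ LinearMap.single A (fun _ : Fin n1 => (Q : Type)) j)
            = 0 := by
          ext q
          simp only [p, LinearMap.comp_apply, hrs', LinearMap.zero_apply]
          exact (hex _).2 ⟨_, rfl⟩
        rw [h4, ev_zero] at h3
        exact h3
      have h3 : φn (z - s (r z)) = 0 := by
        have : z - s (r z) = ∑ j, (jn j (z j) - s (r (jn j (z j)))) := by
          rw [Finset.sum_sub_distrib, ← hsum z]
          simp only [← map_sum]
          rw [← hsum z]
        rw [this, map_sum]
        refine Finset.sum_eq_zero fun j _ => ?_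
        have h3 := key (jn j - s ∘ₗ r ∘ₗ jn j) (z j)
        have h4 : p ∘ₗ (jn j - s ∘ₗ r ∘ₗ jn j) = 0 := by
          apply LinearMap.ext
          intro q
          simp [p, hrs']
        rw [h4, ev_zero] at h3
        exact h3
      rw [h1, map_add, h2, h3, add_zero]
    obtain ⟨φ, hφ⟩ := desc_surj (p.restrictScalars k) hp φn hz
    refine ⟨φ, fun q f => ?_⟩
    obtain ⟨g, rfl⟩ := hpl f
    rw [← key, ← hφ]
    rfl

end Functor
end Aux
end Paper
end Helpers3

noncomputable section Helpers4
namespace Paper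
namespace Aux
open CategoryTheory

section Cent
variable {A : Type} [Ring A] {Q : ModuleCat.{0} A}

theorem comm_mat (c : Q →ₗ[Module.End A Q] Q) {n m : ℕ} (T : (Fin n → Q) →ₗ[A] (Fin m → Q))
    (x : Fin n → Q) : T (fun j => c (x j)) = fun l => c (T x l) := by
  have hsum : ∀ z : Fin n → Q, T z = ∑ j, T (LinearMap.single A (fun _ => (Q : Type)) j (z j)) := by
    intro z
    rw [← map_sum]
    congr 1
    exact (LinearMap.sum_single_apply (fun _ : Fin n => (Q : Type)) z).symm
  funext l
  rw [hsum, hsum x, Finset.sum_apply, Finset.sum_apply, map_sum]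
  refine Finset.sum_congr rfl fun j _ => ?_
  exact (c.map_smul (LinearMap.proj l ∘ₗ T ∘ₗ LinearMap.single A (fun _ => (Q : Type)) j :
    Module.End A Q) (x j)).symm

theorem dom_cent (h : domdimGE A Q (ModuleCat.of A A) 2) :
    (∀ a : A, (∀ q : Q, a • q = 0) → a = 0) ∧
    ∀ c : Q →ₗ[Module.End A Q] Q, ∃ a : A, ∀ q, c q = a • q := by
  obtain h | ⟨M, ι, d, h1, h2, h3, -, h5, h6, -⟩ := h
  · omega
  obtain ⟨n, s, r, hrs⟩ := h1 0 (by omega)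
  obtain ⟨n1, s1, r1, hrs1⟩ := h1 1 (by omega)
  have hex := h3 le_rfl
  have hrs' : ∀ x, r (s x) = x := fun x => LinearMap.congr_fun hrs x
  have hrs1' : ∀ x, r1 (s1 x) = x := fun x => LinearMap.congr_fun hrs1 x
  have hι : ∀ a : A, ι a = a • ι (1 : A) := by
    intro a
    rw [← map_smul]; congr 1
    exact (mul_one a).symm
  let x : Fin n → Q := s (ι (1 : A))
  constructor
  · intro a ha
    apply h2
    rw [map_zero, hι, ← hrs' (ι (1 : A)), ← map_smul]
    have : a • s (ι (1 : A)) = 0 := by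
      funext j; exact ha _
    rw [this, map_zero]
  · intro c
    let y : Fin n → Q := fun j => c (x j)
    have hy1 : s (r y) = y := by
      have := comm_mat c (s ∘ₗ r) x
      simp only [LinearMap.comp_apply] at this
      rw [this]
      simp only [x, hrs']
      rfl
    have hy2 : d 0 (r y) = 0 := by
      have := comm_mat c (s1 ∘ₗ d 0 ∘ₗ r) x
      simp only [LinearMap.comp_apply, x, hrs'] at this
      rw [(hex _).2 ⟨_, rfl⟩, map_zero] at this
      rw [← hrs1' (d 0 (r y))]
      change r1 (s1 (d 0 (r (fun j => c (s (ι (1 : A)) j))))) = 0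
      rw [this]
      simp only [Pi.zero_apply, map_zero]
      exact map_zero r1
    obtain ⟨a, ha⟩ := (hex _).1 hy2
    have hya : y = (a : A) • x := by
      rw [← hy1, ← ha]
      change s (ι a) = (show A from a) • s (ι (1 : A))
      rw [← map_smul, ← hι]
    refine ⟨a, fun q => ?_⟩
    obtain ⟨h, hh⟩ := h5 (LinearMap.toSpanSingleton A Q q)
    have hq : q = (h ∘ₗ r) x := by
      have := LinearMap.congr_fun hh (1 : A)
      simp only [x, LinearMap.comp_apply, hrs'] at this ⊢
      rw [this]
      exact (one_smul A q).symm
    let T : (Fin n → Q) →ₗ[A] (Fin 1 → Q) := LinearMap.pi (fun _ => h ∘ₗ r)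
    have hT := congrFun (comm_mat c T x) 0
    change (h ∘ₗ r) y = c ((h ∘ₗ r) x) at hT
    rw [hq, ← hT, hya, map_smul]

end Cent

theorem dual_ne (k : Type) [Field k] {V : Type} [AddCommGroup V] [Module k V] {v : V} (hv : v ≠ 0) :
    ∃ ξ : V →ₗ[k] k, ξ v ≠ 0 := by
  by_contra hcon
  push Not at hcon
  exact hv ((Module.forall_dual_apply_eq_zero_iff k v).1 hcon)

section DAsec
variable (k : Type) [Field k] (A : Type) [Ring A] [Algebra k A]

/-- the dual of the right regular module -/
def DA : Type := A →ₗ[k] k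

instance : AddCommGroup (DA k A) := inferInstanceAs (AddCommGroup (A →ₗ[k] k))

variable {k A}
/-- apply -/
def DA.ap (g : DA k A) (a : A) : k := (show A →ₗ[k] k from g) a

theorem DA.ext {g g' : DA k A} (h : ∀ a, g.ap a = g'.ap a) : g = g' :=
  LinearMap.ext (σ := RingHom.id k) (M := A) h

instance : Module A (DA k A) where
  smul b g := (show A →ₗ[k] k from g) ∘ₗ (LinearMap.mulRight k b)
  one_smul g := DA.ext fun a => congrArg (DA.ap g) (mul_one a)
  mul_smul b c g := DA.ext fun a => congrArg (DA.ap g) (mul_assoc a b c).symm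
  smul_zero b := rfl
  smul_add b g g' := rfl
  add_smul b c g := DA.ext fun a => by
    change (show A →ₗ[k] k from g) (a * (b + c)) = _
    rw [mul_add, map_add]; rfl
  zero_smul g := DA.ext fun a => by
    change (show A →ₗ[k] k from g) (a * 0) = _
    rw [mul_zero, map_zero]; rfl

theorem DA.smul_ap (b : A) (g : DA k A) (a : A) : (b • g).ap a = g.ap (a * b) := rfl
theorem DA.add_ap (g g' : DA k A) (a : A) : (g + g').ap a = g.ap a + g'.ap a := rfl
theorem DA.zero_ap (a : A) : (0 : DA k A).ap a = 0 := rfl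
theorem DA.ap_add (g : DA k A) (a b : A) : g.ap (a + b) = g.ap a + g.ap b :=
  map_add (show A →ₗ[k] k from g) a b
theorem DA.ap_smul (g : DA k A) (c : k) (b : A) : g.ap (c • b) = c * g.ap b :=
  map_smul (show A →ₗ[k] k from g) c b

/-- coinduction -/
def coind {Y : ModuleCat.{0} A} (ξ : Y →ₗ[k] k) : Y →ₗ[A] DA k A where
  toFun y := (show A →ₗ[k] k from
    { toFun := fun a => ξ (a • y)
      map_add' := fun a b => by rw [add_smul, map_add]
      map_smul' := fun c a => by rw [smul_assoc, map_smul]; rfl })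
  map_add' y y' := DA.ext fun a => by
    change ξ (a • (y + y')) = ξ (a • y) + ξ (a • y')
    rw [smul_add, map_add]
  map_smul' b y := DA.ext fun a => by
    change ξ (a • b • y) = ξ ((a * b) • y)
    rw [mul_smul]

theorem coind_ap {Y : ModuleCat.{0} A} (ξ : Y →ₗ[k] k) (y : Y) (a : A) :
    (coind ξ y).ap a = ξ (a • y) := rfl

variable (k A) in
/-- finite powers of the cogenerator -/
def IA (n : ℕ) : ModuleCat.{0} A := ModuleCat.of A (Fin n → DA k A)

theorem DA_smul_k {n : ℕ} (c : k) (g : IA k A n) (j : Fin n) (a : A) :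
    DA.ap ((show Fin n → DA k A from c • g) j) a = c * DA.ap ((show Fin n → DA k A from g) j) a := by
  change DA.ap ((show Fin n → DA k A from g) j) (a * algebraMap k A c) = _
  rw [← Algebra.commutes, ← Algebra.smul_def, DA.ap_smul]

theorem IA_ext (n : ℕ) (X' Y' : ModuleCat.{0} A) (f' : X' →ₗ[A] Y') (hf : Function.Injective f')
    (g : X' →ₗ[A] IA k A n) : ∃ h : Y' →ₗ[A] IA k A n, ∀ x, h (f' x) = g x := by
  obtain ⟨r, hr⟩ := LinearMap.exists_leftInverse_of_injective (f'.restrictScalars k)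
    (LinearMap.ker_eq_bot.2 hf)
  let ξ : Fin n → (X' →ₗ[k] k) := fun j =>
    { toFun := fun x => DA.ap ((show Fin n → DA k A from g x) j) 1
      map_add' := fun x y => by rw [map_add]; rfl
      map_smul' := fun c x => by
        have : g (c • x) = c • g x := map_smul g (algebraMap k A c) x
        rw [this, DA_smul_k]; rfl }
  refine ⟨(LinearMap.pi fun j => coind (Y := Y') (ξ j ∘ₗ r) : Y' →ₗ[A] (Fin n → DA k A)), fun x => ?_⟩
  funext j
  apply DA.ext
  intro a
  change ξ j (r (a • f' x)) = DA.ap ((show Fin n → DA k A from g x) j) a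
  rw [← map_smul]
  have : r (f' (a • x)) = a • x := LinearMap.congr_fun hr (a • x)
  rw [this]
  change DA.ap ((show Fin n → DA k A from g (a • x)) j) 1 = _
  rw [map_smul]
  change DA.ap ((show Fin n → DA k A from g x) j) (1 * a) = _
  rw [one_mul]

theorem IA_inj (n : ℕ) : Module.Injective A (IA k A n) := by
  refine ⟨fun X Y _ _ _ _ f hf g => ?_⟩
  exact IA_ext n (ModuleCat.of A X) (ModuleCat.of A Y) f hf g

theorem exists_embed (X : ModuleCat.{0} A) [FiniteDimensional k X] :
    ∃ (n : ℕ) (i : X →ₗ[A] IA k A n), Function.Injective i := by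
  let b := Module.finBasis k X
  refine ⟨_, (LinearMap.pi fun j => coind (b.coord j) :
    X →ₗ[A] (Fin (Module.finrank k X) → DA k A)), ?_⟩
  intro x y hxy
  apply b.ext_elem
  intro j
  have := congrArg (fun g => DA.ap g 1) (congrFun hxy j)
  change b.coord j ((1 : A) • x) = b.coord j ((1 : A) • y) at this
  simpa using this

instance IA_fd [FiniteDimensional k A] (n : ℕ) : FiniteDimensional k (IA k A n) := by
  let e : IA k A n →ₗ[k] (Fin n → (A →ₗ[k] k)) :=
    { toFun := fun g => (show Fin n → DA k A from g)
      map_add' := fun g h => rfl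
      map_smul' := fun c g => by
        funext j
        apply LinearMap.ext
        intro a
        exact DA_smul_k c g j a }
  exact FiniteDimensional.of_injective e (fun g h hgh => hgh)

end DAsec

section IAprops
variable {k : Type} [Field k] {A : Type} [Ring A] [Algebra k A] {Q : ModuleCat.{0} A}

/-- coordinates -/
def crd {n : ℕ} (g : IA k A n) (j : Fin n) : DA k A := (show Fin n → DA k A from g) j

/-- inclusion of coordinate -/
def inc {n : ℕ} (j : Fin n) : ModuleCat.of A (DA k A) →ₗ[A] IA k A n :=
  LinearMap.single A (fun _ : Fin n => DA k A) j

theorem ap_dual [FiniteDimensional k Q] (w : (Q →ₗ[k] k) →ₗ[k] k) :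
    ∃ q : Q, ∀ ξ, w ξ = ξ q := by
  obtain ⟨q, hq⟩ := (Module.evalEquiv k Q).surjective w
  exact ⟨q, fun ξ => by rw [← hq]; rfl⟩

/-- `Q^n → F(I_n)` -/
def theta (n : ℕ) : (Fin n → Q) →ₗ[Module.End A Q] FF k Q (IA k A n) where
  toFun q := mkF (fun f => ∑ j, (crd (f (q j)) j).ap 1)
    (fun f g => by rw [← Finset.sum_add_distrib]; rfl)
    (fun c f => by
      rw [Finset.mul_sum]
      exact Finset.sum_congr rfl fun j _ => DA_smul_k c (f (q j)) j 1)
  map_add' q q' := ev_ext fun f => by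
    rw [add_ev, ev_mkF, ev_mkF, ev_mkF, ← Finset.sum_add_distrib]
    refine Finset.sum_congr rfl fun j _ => ?_
    rw [Pi.add_apply, map_add]; rfl
  map_smul' e q := ev_ext fun f => rfl

theorem ev_theta (n : ℕ) (q : Fin n → Q) (f : Q →ₗ[A] IA k A n) :
    ev (theta n q) f = ∑ j, (crd (f (q j)) j).ap 1 := rfl

theorem crd_inc {n : ℕ} (j l : Fin n) (g : DA k A) : crd (inc j g) l = if l = j then g else 0 := by
  change (Pi.single j g : Fin n → DA k A) l = _
  rw [Pi.single_apply]

theorem ev_theta_inc (n : ℕ) (q : Fin n → Q) (j : Fin n) (ξ : Q →ₗ[k] k) :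
    ev (theta n q) (inc j ∘ₗ coind ξ) = ξ (q j) := by
  rw [ev_theta, Finset.sum_eq_single j]
  · rw [LinearMap.comp_apply, crd_inc, if_pos rfl, coind_ap, one_smul]
  · intro l _ hl
    rw [LinearMap.comp_apply, crd_inc, if_neg hl]; rfl
  · simp

theorem hom_IA {n : ℕ} (f : Q →ₗ[A] IA k A n) : ∃ ξ : Fin n → (Q →ₗ[k] k),
    f = ∑ j, inc j ∘ₗ coind (ξ j) := by
  refine ⟨fun j =>
    { toFun := fun q => (crd (f q) j).ap 1
      map_add' := fun x y => by rw [map_add]; rfl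
      map_smul' := fun c x => by
        have : f (c • x) = c • f x := map_smul f (algebraMap k A c) x
        rw [this]; exact DA_smul_k c (f x) j 1 }, ?_⟩
  apply LinearMap.ext
  intro q
  rw [LinearMap.sum_apply]
  have h1 : f q = ∑ j, inc j (crd (f q) j) :=
    (LinearMap.sum_single_apply (fun _ : Fin n => DA k A) (f q)).symm
  rw [h1]
  refine Finset.sum_congr rfl fun j _ => ?_
  rw [LinearMap.comp_apply]
  congr 1
  apply DA.ext
  intro a
  rw [coind_ap]
  change _ = (crd (f (a • q)) j).ap 1
  rw [map_smul]
  change _ = (crd (f q) j).ap (1 * a)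
  rw [one_mul]

theorem theta_bij [FiniteDimensional k Q] (n : ℕ) :
    Function.Bijective (theta (k := k) (Q := Q) n) := by
  constructor
  · intro q q' h
    funext j
    rw [← sub_eq_zero]
    by_contra hne
    obtain ⟨ξ, hξ⟩ := dual_ne k hne
    apply hξ
    rw [map_sub, sub_eq_zero, ← ev_theta_inc, ← ev_theta_inc, h]
  · intro w
    have : ∀ j, ∃ q : Q, ∀ ξ : Q →ₗ[k] k, ev w (inc j ∘ₗ coind ξ) = ξ q := by
      intro j
      exact ap_dual
        { toFun := fun ξ => ev w (inc j ∘ₗ coind ξ)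
          map_add' := fun ξ ξ' => by
            rw [← ev_add, ← LinearMap.comp_add]; rfl
          map_smul' := fun c ξ => by
            rw [RingHom.id_apply, smul_eq_mul, ← ev_smul]
            congr 1
            apply LinearMap.ext
            intro q
            funext l
            apply DA.ext
            intro a
            refine Eq.trans ?_ (DA_smul_k c (inc j (coind ξ q)) l a).symm
            change (crd (inc j (coind (c • ξ) q)) l).ap a = c * (crd (inc j (coind ξ q)) l).ap a
            rw [crd_inc, crd_inc]
            split_ifs
            · rfl
            · simp [DA.zero_ap] }
    choose q hq using this
    refine ⟨q, ev_ext fun f => ?_⟩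
    obtain ⟨ξ, rfl⟩ := hom_IA f
    rw [ev_sum, ev_sum]
    refine Finset.sum_congr rfl fun j _ => ?_
    rw [ev_theta_inc, hq]

theorem IA_ASurj [FiniteDimensional k Q] (n : ℕ)
    (hc : ∀ c : Q →ₗ[Module.End A Q] Q, ∃ a : A, ∀ q, c q = a • q) : ASurj k Q (IA k A n) := by
  intro u
  let e := LinearEquiv.ofBijective (theta (k := k) (Q := Q) n) (theta_bij n)
  have := fun j => hc (LinearMap.proj j ∘ₗ e.symm.toLinearMap ∘ₗ u)
  choose a ha using this
  refine ⟨
    { toFun := fun g => ∑ j, (crd g j).ap (a j)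
      map_add' := fun g h => by rw [← Finset.sum_add_distrib]; rfl
      map_smul' := fun c g => by
        rw [RingHom.id_apply, smul_eq_mul, Finset.mul_sum]
        exact Finset.sum_congr rfl fun j _ => DA_smul_k c g j (a j) }, fun q f => ?_⟩
  have h1 : u q = theta n (e.symm (u q)) := (e.apply_symm_apply (u q)).symm
  rw [h1, ev_theta]
  change _ = ∑ j, (crd (f q) j).ap (a j)
  refine Finset.sum_congr rfl fun j _ => ?_
  have h2 : e.symm (u q) j = a j • q := ha j q
  rw [h2, map_smul]
  change (crd (f q) j).ap (1 * a j) = _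
  rw [one_mul]

theorem IA_AInj [FiniteDimensional k A] (n : ℕ)
    (hf : ∀ a : A, (∀ q : Q, a • q = 0) → a = 0) : AInj k Q (IA k A n) := by
  intro φ hφ
  have h0 : ∀ j (g : DA k A), φ (inc j g) = 0 := by
    intro j
    let w : (A →ₗ[k] k) →ₗ[k] k :=
      { toFun := fun g => φ (inc j (show DA k A from g))
        map_add' := fun g h => by
          rw [← map_add φ, ← map_add]; rfl
        map_smul' := fun c g => by
          rw [RingHom.id_apply, ← map_smul φ]
          congr 1
          funext l
          apply DA.ext
          intro a
          refine Eq.trans ?_ (DA_smul_k c (inc j (show DA k A from g)) l a).symm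
          change (crd (inc j (show DA k A from (c • g))) l).ap a
            = c * (crd (inc j (show DA k A from g)) l).ap a
          rw [crd_inc, crd_inc]
          split_ifs
          · rfl
          · simp [DA.zero_ap] }
    obtain ⟨a, ha⟩ := (Module.evalEquiv k A).surjective w
    have ha' : ∀ g : DA k A, φ (inc j g) = g.ap a := fun g => (LinearMap.congr_fun ha g).symm
    have : a = 0 := by
      apply hf
      intro q
      by_contra hne
      obtain ⟨ξ, hξ⟩ := dual_ne k hne
      apply hξ
      have h1 := hφ (inc j ∘ₗ coind ξ) q
      rw [LinearMap.comp_apply, ha', coind_ap] at h1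
      exact h1
    intro g
    rw [ha', this]
    exact map_zero (show A →ₗ[k] k from g)
  apply LinearMap.ext
  intro g
  have h1 : g = ∑ j, inc j (crd g j) :=
    (LinearMap.sum_single_apply (fun _ : Fin n => DA k A) g).symm
  rw [h1, map_sum, LinearMap.zero_apply]
  exact Finset.sum_eq_zero fun j _ => h0 j _

theorem F_inAdd [FiniteDimensional k Q] {X : ModuleCat.{0} A} {n : ℕ} (i : X →ₗ[A] IA k A n)
    (p : IA k A n →ₗ[A] X) (hpi : p ∘ₗ i = LinearMap.id) :
    InAdd (Module.End A Q) (ModuleCat.of (Module.End A Q) Q) (FF k Q X) := by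
  let e := LinearEquiv.ofBijective (theta (k := k) (Q := Q) n) (theta_bij n)
  refine ⟨n, e.symm.toLinearMap ∘ₗ Fmap p, Fmap i ∘ₗ e.toLinearMap, ?_⟩
  apply LinearMap.ext
  intro w
  change Fmap i (e (e.symm (Fmap p w))) = w
  rw [e.apply_symm_apply]
  apply ev_ext
  intro f
  rw [ev_Fmap, ev_Fmap, ← LinearMap.comp_assoc, hpi, LinearMap.id_comp]

theorem main_le [FiniteDimensional k A] [FiniteDimensional k Q]
    (hf : ∀ a : A, (∀ q : Q, a • q = 0) → a = 0)
    (hc : ∀ c : Q →ₗ[Module.End A Q] Q, ∃ a : A, ∀ q, c q = a • q) (m : ℕ) :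
    ∀ X : ModuleCat.{0} A, FiniteDimensional k X → (∀ i, 1 ≤ i → ExtVanish A Q X i) →
      AInj k Q X → ASurj k Q X → HasInjectiveDimensionLT X (m + 1) →
      RelAddDimLE (Module.End A Q) (ModuleCat.of (Module.End A Q) Q) (FF k Q X) m := by
  induction m with
  | zero =>
    intro X _ _ _ _ hX
    rw [zero_add, ← injDim_zero] at hX
    obtain ⟨n, i, hi⟩ := exists_embed (k := k) X
    obtain ⟨p, hp⟩ := hX.out i hi LinearMap.id
    exact res_zero (F_inAdd i p (LinearMap.ext hp))
  | succ m ih =>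
    intro X _ hE hXi hXs hX
    obtain ⟨n, i, hi⟩ := exists_embed (k := k) X
    let C : ModuleCat.{0} A := ModuleCat.of A (IA k A n ⧸ LinearMap.range i)
    let p : IA k A n →ₗ[A] C := (LinearMap.range i).mkQ
    have hp : Function.Surjective p := Submodule.mkQ_surjective _
    have hex : Function.Exact i p := LinearMap.exact_map_mkQ_range i
    have hl := ext_lift i p hi hp hex (hE 1 le_rfl)
    have hCfd : FiniteDimensional k C := Module.Finite.of_surjective (p.restrictScalars k) hp
    have hCE : ∀ i, 1 ≤ i → ExtVanish A Q C i := by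
      rintro (_ | l) hl'
      · omega
      · exact ext_shift i p hi hp hex (IA_inj n) l (hE (l+2) (by omega))
    have hCi : AInj k Q C := AInj_quot p hp (IA_AInj n hf)
    have hCs : ASurj k Q C := ASurj_quot i p hp hex (IA_ASurj n hc) hXi hl
    have hCd := (injDim_ses i p hi hp hex (IA_inj n) m).2 hX
    refine res_cons (P := FF k Q (IA k A n)) (Fmap p) (Fmap i) (Fmap_inj p hl) (Fmap_surj i hi)
      (Fmap_exact i p hi hex) (F_inAdd LinearMap.id LinearMap.id rfl) ?_
      (ih C hCfd hCE hCi hCs hCd)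
    intro u
    obtain ⟨φ, hφ⟩ := hXs u
    obtain ⟨ψ, hψ⟩ := LinearMap.dualMap_surjective_of_injective
      (f := i.restrictScalars k) hi φ
    refine ⟨alpha ψ, ?_⟩
    apply LinearMap.ext
    intro q
    apply ev_ext
    intro f
    refine Eq.trans ?_ (hφ q f).symm
    exact LinearMap.congr_fun hψ (f q)

end IAprops
end Aux
end Paper
end Helpers4

noncomputable section Helpers5
namespace Paper
namespace Aux
open CategoryTheory

section GG
variable {k : Type} [Field k] {A : Type} [Ring A] [Algebra k A] {Q : ModuleCat.{0} A}

/-- precomposition with multiplication by `a` -/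
def pre {Z : ModuleCat.{0} (Module.End A Q)} (h : Q →ₗ[Module.End A Q] Z) (a : A) :
    Q →ₗ[Module.End A Q] Z where
  toFun q := h (a • q)
  map_add' x y := by rw [smul_add, map_add]
  map_smul' e x := by
    rw [RingHom.id_apply, ← map_smul]
    congr 1
    exact (map_smul e a x).symm

theorem pre_apply {Z : ModuleCat.{0} (Module.End A Q)} (h : Q →ₗ[Module.End A Q] Z) (a : A) (q : Q) :
    pre h a q = h (a • q) := rfl

theorem k_smul_hom {Z : ModuleCat.{0} (Module.End A Q)} (h : Q →ₗ[Module.End A Q] Z) (c : k)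
    (q : Q) : (c • h) q = h (c • q) := by
  change algebraMap k (Module.End A Q) c • h q = _
  rw [← map_smul, Module.End.smul_def, Module.algebraMap_end_apply]

theorem pre_smul {Z : ModuleCat.{0} (Module.End A Q)} (h : Q →ₗ[Module.End A Q] Z) (c : k) (a : A) :
    pre h (c • a) = c • pre h a := by
  apply LinearMap.ext
  intro q
  rw [k_smul_hom, pre_apply, pre_apply, smul_assoc, smul_comm]

theorem pre_add {Z : ModuleCat.{0} (Module.End A Q)} (h : Q →ₗ[Module.End A Q] Z) (a b : A) :
    pre h (a + b) = pre h a + pre h b := by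
  apply LinearMap.ext
  intro q
  rw [LinearMap.add_apply, pre_apply, pre_apply, pre_apply, add_smul, map_add]

variable (k) in
/-- the dual of `Hom_E(Q, Z)` -/
def GT (Z : ModuleCat.{0} (Module.End A Q)) : Type := (Q →ₗ[Module.End A Q] Z) →ₗ[k] k

instance (Z : ModuleCat.{0} (Module.End A Q)) : AddCommGroup (GT k Z) :=
  inferInstanceAs (AddCommGroup ((Q →ₗ[Module.End A Q] Z) →ₗ[k] k))

/-- evaluate -/
def GT.ap {Z : ModuleCat.{0} (Module.End A Q)} (w : GT k Z) (h : Q →ₗ[Module.End A Q] Z) : k :=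
  (show (Q →ₗ[Module.End A Q] Z) →ₗ[k] k from w) h

theorem GT.ext {Z : ModuleCat.{0} (Module.End A Q)} {w w' : GT k Z}
    (h : ∀ f, w.ap f = w'.ap f) : w = w' :=
  LinearMap.ext (σ := RingHom.id k) (M := (Q →ₗ[Module.End A Q] Z)) h

theorem GT.ap_add {Z : ModuleCat.{0} (Module.End A Q)} (w : GT k Z)
    (f g : Q →ₗ[Module.End A Q] Z) : w.ap (f + g) = w.ap f + w.ap g :=
  map_add (show (Q →ₗ[Module.End A Q] Z) →ₗ[k] k from w) f g

theorem GT.ap_zero {Z : ModuleCat.{0} (Module.End A Q)} (w : GT k Z) :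
    w.ap (0 : Q →ₗ[Module.End A Q] Z) = 0 :=
  map_zero (show (Q →ₗ[Module.End A Q] Z) →ₗ[k] k from w)

theorem GT.ap_sum {Z : ModuleCat.{0} (Module.End A Q)} (w : GT k Z) {ι : Type} (s : Finset ι)
    (f : ι → (Q →ₗ[Module.End A Q] Z)) : w.ap (∑ j ∈ s, f j) = ∑ j ∈ s, w.ap (f j) :=
  map_sum (show (Q →ₗ[Module.End A Q] Z) →ₗ[k] k from w) f s

theorem GT.ap_smul {Z : ModuleCat.{0} (Module.End A Q)} (w : GT k Z) (c : k)
    (f : Q →ₗ[Module.End A Q] Z) : w.ap (c • f) = c * w.ap f :=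
  map_smul (show (Q →ₗ[Module.End A Q] Z) →ₗ[k] k from w) c f

/-- constructor -/
def GT.mk {Z : ModuleCat.{0} (Module.End A Q)} (w : (Q →ₗ[Module.End A Q] Z) → k)
    (h1 : ∀ f g, w (f + g) = w f + w g) (h2 : ∀ (c : k) f, w (c • f) = c * w f) : GT k Z :=
  (show (Q →ₗ[Module.End A Q] Z) →ₗ[k] k from
  { toFun := w, map_add' := h1, map_smul' := h2 })

theorem GT.add_ap {Z : ModuleCat.{0} (Module.End A Q)} (w w' : GT k Z)
    (f : Q →ₗ[Module.End A Q] Z) : (w + w').ap f = w.ap f + w'.ap f := rfl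

instance (Z : ModuleCat.{0} (Module.End A Q)) : Module A (GT k Z) where
  smul a w := GT.mk (fun h => w.ap (pre h a)) (fun f g => by rw [← GT.ap_add]; rfl)
    (fun c f => by
      rw [← GT.ap_smul]; rfl)
  one_smul w := GT.ext fun f => congrArg w.ap (LinearMap.ext fun q => by
    rw [pre_apply, one_smul])
  mul_smul a b w := GT.ext fun f => congrArg w.ap (LinearMap.ext fun q => by
    rw [pre_apply, pre_apply, pre_apply, mul_smul])
  smul_zero a := rfl
  smul_add a w w' := rfl
  add_smul a b w := GT.ext fun f => by
    change w.ap (pre f (a + b)) = w.ap (pre f a) + w.ap (pre f b)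
    rw [pre_add, GT.ap_add]
  zero_smul w := GT.ext fun f => by
    change w.ap (pre f 0) = 0
    rw [← GT.ap_zero w]
    congr 1
    apply LinearMap.ext
    intro q
    rw [pre_apply, zero_smul, map_zero]; rfl

theorem GT.smul_ap {Z : ModuleCat.{0} (Module.End A Q)} (a : A) (w : GT k Z)
    (f : Q →ₗ[Module.End A Q] Z) : (a • w).ap f = w.ap (pre f a) := rfl

/-- functoriality -/
def Gmap {Y Z : ModuleCat.{0} (Module.End A Q)} (g : Y →ₗ[Module.End A Q] Z) :
    GT k Z →ₗ[A] GT k Y where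
  toFun w := GT.mk (fun h => w.ap (g ∘ₗ h)) (fun f f' => by rw [LinearMap.comp_add, GT.ap_add])
    (fun c f => by
      rw [← GT.ap_smul]
      congr 1
      apply LinearMap.ext
      intro q
      rw [k_smul_hom, LinearMap.comp_apply, k_smul_hom]; rfl)
  map_add' w w' := GT.ext fun f => rfl
  map_smul' a w := GT.ext fun f => rfl

theorem Gmap_ap {Y Z : ModuleCat.{0} (Module.End A Q)} (g : Y →ₗ[Module.End A Q] Z) (w : GT k Z)
    (h : Q →ₗ[Module.End A Q] Y) : (Gmap g w).ap h = w.ap (g ∘ₗ h) := rfl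

theorem Gmap_injective {P Z : ModuleCat.{0} (Module.End A Q)} (p : P →ₗ[Module.End A Q] Z)
    (hl : ∀ f : Q →ₗ[Module.End A Q] Z, ∃ h : Q →ₗ[Module.End A Q] P, p ∘ₗ h = f) :
    Function.Injective (Gmap (k := k) p) := by
  intro w w' h
  apply GT.ext
  intro f
  obtain ⟨g, rfl⟩ := hl f
  rw [← Gmap_ap, h, Gmap_ap]

/-- postcomposition as a `k`-linear map -/
def post {Y Z : ModuleCat.{0} (Module.End A Q)} (g : Y →ₗ[Module.End A Q] Z) :
    (Q →ₗ[Module.End A Q] Y) →ₗ[k] (Q →ₗ[Module.End A Q] Z) where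
  toFun h := g ∘ₗ h
  map_add' f f' := LinearMap.comp_add _ _ _
  map_smul' c f := by
    apply LinearMap.ext
    intro q
    rw [RingHom.id_apply, k_smul_hom, LinearMap.comp_apply, k_smul_hom]; rfl

theorem Gmap_surjective {K P : ModuleCat.{0} (Module.End A Q)} (i : K →ₗ[Module.End A Q] P)
    (hi : Function.Injective i) : Function.Surjective (Gmap (k := k) i) := by
  intro w
  have hc : Function.Injective (post (k := k) i) := by
    intro f g h
    apply LinearMap.ext
    intro q
    exact hi (LinearMap.congr_fun h q)
  obtain ⟨v, hv⟩ := LinearMap.dualMap_surjective_of_injective hc w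
  exact ⟨v, hv⟩

theorem Gmap_exact {K P Z : ModuleCat.{0} (Module.End A Q)} (i : K →ₗ[Module.End A Q] P)
    (p : P →ₗ[Module.End A Q] Z) (hi : Function.Injective i) (hex : Function.Exact i p) :
    Function.Exact (Gmap (k := k) p) (Gmap (k := k) i) := by
  intro w
  constructor
  · intro hw
    have : (show (Q →ₗ[Module.End A Q] P) →ₗ[k] k from w) ∈
        LinearMap.range (post (k := k) p).dualMap := by
      rw [LinearMap.range_dualMap_eq_dualAnnihilator_ker, Submodule.mem_dualAnnihilator]
      intro f hf
      obtain ⟨g, hg⟩ := lift_ker i hi f (fun x => (hex _).1 (LinearMap.congr_fun hf x))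
      have h1 : f = i ∘ₗ g := by
        apply LinearMap.ext; intro x; exact (hg x).symm
      change w.ap f = 0
      rw [h1, ← Gmap_ap, hw]; rfl
    obtain ⟨v, hv⟩ := this
    exact ⟨v, hv⟩
  · rintro ⟨v, rfl⟩
    apply GT.ext
    intro f
    rw [Gmap_ap, Gmap_ap, ← LinearMap.comp_assoc]
    have : p ∘ₗ i = 0 := by
      apply LinearMap.ext; intro x; exact (hex _).2 ⟨x, rfl⟩
    rw [this, LinearMap.zero_comp, GT.ap_zero]; rfl

theorem GT_inj (hf : ∀ a : A, (∀ q : Q, a • q = 0) → a = 0)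
    (hc : ∀ c : Q →ₗ[Module.End A Q] Q, ∃ a : A, ∀ q, c q = a • q)
    {P : ModuleCat.{0} (Module.End A Q)}
    (hP : InAdd (Module.End A Q) (ModuleCat.of (Module.End A Q) Q) P) :
    Module.Injective A (GT k P) := by
  obtain ⟨n, s, r, hrs⟩ := hP
  have hrs' : ∀ x, r (s x) = x := fun x => LinearMap.congr_fun hrs x
  have hun : ∀ a b : A, (∀ q : Q, a • q = b • q) → a = b := by
    intro a b h
    rw [← sub_eq_zero]
    apply hf
    intro q
    rw [sub_smul, h, sub_self]
  let sg : Fin n → (Q →ₗ[Module.End A Q] (Fin n → Q)) := fun j =>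
    LinearMap.single (Module.End A Q) (fun _ => (Q : Type)) j
  let rj : Fin n → (Q →ₗ[Module.End A Q] P) := fun j => r ∘ₗ sg j
  have hsum : ∀ z : Fin n → Q, z = ∑ j, sg j (z j) := fun z =>
    (LinearMap.sum_single_apply (fun _ : Fin n => (Q : Type)) z).symm
  let sj : Fin n → (P →ₗ[Module.End A Q] Q) := fun j => LinearMap.proj j ∘ₗ s
  have hex : ∀ (h : Q →ₗ[Module.End A Q] P) (j : Fin n), ∃ a : A, ∀ q, sj j (h q) = a • q :=
    fun h j => hc (sj j ∘ₗ h)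
  choose al hal using hex
  have hdec : ∀ h : Q →ₗ[Module.End A Q] P, h = ∑ j, pre (rj j) (al h j) := by
    intro h
    apply LinearMap.ext
    intro q
    rw [LinearMap.sum_apply, ← hrs' (h q), hsum (s (h q)), map_sum]
    refine Finset.sum_congr rfl fun j _ => ?_
    rw [pre_apply, ← hal]; rfl
  let S : GT k P →ₗ[A] (Fin n → DA k A) :=
    { toFun := fun w j => (show A →ₗ[k] k from
        { toFun := fun a => w.ap (pre (rj j) a)
          map_add' := fun a b => by rw [pre_add, GT.ap_add]
          map_smul' := fun c a => by rw [pre_smul, GT.ap_smul]; rfl })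
      map_add' := fun w w' => rfl
      map_smul' := fun a w => by
        funext j
        apply DA.ext
        intro b
        change w.ap (pre (pre (rj j) b) a) = w.ap (pre (rj j) (b * a))
        congr 1
        apply LinearMap.ext
        intro q
        rw [pre_apply, pre_apply, pre_apply, mul_smul] }
  let R : (Fin n → DA k A) →ₗ[A] GT k P :=
    { toFun := fun g => GT.mk (fun h => ∑ j, (g j).ap (al h j))
        (fun f f' => by
          rw [← Finset.sum_add_distrib]
          refine Finset.sum_congr rfl fun j _ => ?_
          rw [← DA.ap_add]
          congr 1
          apply hun
          intro q
          rw [← hal, add_smul, ← hal, ← hal, LinearMap.add_apply, map_add])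
        (fun c f => by
          rw [Finset.mul_sum]
          refine Finset.sum_congr rfl fun j _ => ?_
          rw [← DA.ap_smul]
          congr 1
          apply hun
          intro q
          rw [← hal, k_smul_hom, hal, smul_assoc, smul_comm])
      map_add' := fun g g' => GT.ext fun f => by
        change ∑ j, ((g + g') j).ap (al f j) = ∑ j, (g j).ap (al f j) + ∑ j, (g' j).ap (al f j)
        rw [← Finset.sum_add_distrib]; rfl
      map_smul' := fun a g => GT.ext fun f => by
        change ∑ j, ((a • g) j).ap (al f j) = ∑ j, (g j).ap (al (pre f a) j)
        refine Finset.sum_congr rfl fun j _ => ?_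
        rw [Pi.smul_apply, DA.smul_ap]
        congr 1
        apply hun
        intro q
        rw [← hal, pre_apply, hal, mul_smul] }
  refine inj_of_equiv S R ?_ (IA_inj n)
  intro w
  apply GT.ext
  intro h
  change ∑ j, w.ap (pre (rj j) (al h j)) = w.ap h
  rw [← GT.ap_sum, ← hdec]

theorem G_dim (hf : ∀ a : A, (∀ q : Q, a • q = 0) → a = 0)
    (hc : ∀ c : Q →ₗ[Module.End A Q] Q, ∃ a : A, ∀ q, c q = a • q) (m : ℕ) :
    ∀ Z : ModuleCat.{0} (Module.End A Q),
      RelAddDimLE (Module.End A Q) (ModuleCat.of (Module.End A Q) Q) Z m →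
      HasInjectiveDimensionLT (ModuleCat.of A (GT k Z)) (m + 1) := by
  induction m with
  | zero =>
    intro Z h
    obtain ⟨P, hP, ⟨e⟩⟩ := res_zero' h
    rw [zero_add, ← injDim_zero]
    refine inj_of_equiv (Gmap (k := k) e.toLinearMap) (Gmap e.symm.toLinearMap) ?_
      (GT_inj hf hc hP)
    intro w
    apply GT.ext
    intro f
    rw [Gmap_ap, Gmap_ap]
    congr 1
    apply LinearMap.ext
    intro q
    exact e.apply_symm_apply _
  | succ m ih =>
    intro Z h
    obtain ⟨P, p, hP, hp, hl, hK⟩ := res_uncons h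
    let K : ModuleCat.{0} (Module.End A Q) := ModuleCat.of _ (LinearMap.ker p)
    let i : K →ₗ[Module.End A Q] P := (LinearMap.ker p).subtype
    have hi : Function.Injective i := Subtype.val_injective
    have hex : Function.Exact i p := LinearMap.exact_subtype_ker_map p
    exact (injDim_ses (X := ModuleCat.of A (GT k Z)) (I := ModuleCat.of A (GT k P))
      (C := ModuleCat.of A (GT k K)) (Gmap p) (Gmap i) (Gmap_injective p hl)
      (Gmap_surjective i hi) (Gmap_exact i p hi hex) (GT_inj hf hc hP) m).1 (ih K hK)

theorem GF_equiv (X : ModuleCat.{0} A) [FiniteDimensional k X] (h1 : AInj k Q X)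
    (h2 : ASurj k Q X) : Nonempty (GT k (FF k Q X) ≃ₗ[A] X) := by
  choose be hbe using h2
  have hun : ∀ φ ψ : X →ₗ[k] k, (∀ (f : Q →ₗ[A] X) (q : Q), φ (f q) = ψ (f q)) → φ = ψ := by
    intro φ ψ h
    rw [← sub_eq_zero]
    apply h1
    intro f q
    rw [LinearMap.sub_apply, h, sub_self]
  have hba : ∀ φ : X →ₗ[k] k, be (alpha φ) = φ := by
    intro φ
    apply hun
    intro f q
    rw [← hbe]; rfl
  have hab : ∀ u, alpha (be u) = u := by
    intro u
    apply LinearMap.ext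
    intro q
    apply ev_ext
    intro f
    exact (hbe u q f).symm
  let S : X →ₗ[A] GT k (FF k Q X) :=
    { toFun := fun x => GT.mk (fun u => be u x)
        (fun u v => by
          rw [← LinearMap.add_apply]
          congr 1
          apply hun
          intro f q
          rw [LinearMap.add_apply, ← hbe, ← hbe, ← hbe]; rfl)
        (fun c u => by
          rw [← smul_eq_mul, ← LinearMap.smul_apply]
          congr 1
          apply hun
          intro f q
          rw [LinearMap.smul_apply, ← hbe, k_smul_hom, hbe, ← map_smul]
          congr 1
          exact LinearMap.map_smul_of_tower f c q)
      map_add' := fun x y => GT.ext fun u => map_add (be u) x y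
      map_smul' := fun a x => GT.ext fun u => by
        change be u (a • x) = be (pre u a) x
        let aL : X →ₗ[k] X := DistribMulAction.toLinearMap k X a
        change (be u ∘ₗ aL) x = be (pre u a) x
        congr 1
        apply hun
        intro f q
        rw [← hbe, pre_apply, hbe, map_smul]; rfl }
  refine ⟨(LinearEquiv.ofBijective S ⟨?_, ?_⟩).symm⟩
  · intro x y h
    rw [← sub_eq_zero]
    by_contra hne
    obtain ⟨ξ, hξ⟩ := dual_ne k hne
    apply hξ
    have := congrArg (fun w => GT.ap w (alpha ξ)) h
    change be (alpha ξ) x = be (alpha ξ) y at this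
    rw [hba] at this
    rw [map_sub, this, sub_self]
  · intro w
    obtain ⟨x, hx⟩ := ap_dual (Q := X)
      { toFun := fun φ => w.ap (alpha φ)
        map_add' := fun φ ψ => by
          rw [← GT.ap_add]; rfl
        map_smul' := fun c φ => by
          rw [RingHom.id_apply, smul_eq_mul, ← GT.ap_smul]
          congr 1
          apply LinearMap.ext
          intro q
          apply ev_ext
          intro f
          rw [k_smul_hom, ev_alpha, ev_alpha, LinearMap.map_smul_of_tower f c q, map_smul]; rfl }
    refine ⟨x, GT.ext fun u => ?_⟩
    change be u x = w.ap u
    rw [← hx]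
    change w.ap (alpha (be u)) = _
    rw [hab]

theorem le_main (hf : ∀ a : A, (∀ q : Q, a • q = 0) → a = 0)
    (hc : ∀ c : Q →ₗ[Module.End A Q] Q, ∃ a : A, ∀ q, c q = a • q) (m : ℕ)
    (X : ModuleCat.{0} A) [FiniteDimensional k X] (h1 : AInj k Q X) (h2 : ASurj k Q X)
    (h : RelAddDimLE (Module.End A Q) (ModuleCat.of (Module.End A Q) Q) (FF k Q X) m) :
    HasInjectiveDimensionLT X (m + 1) := by
  obtain ⟨e⟩ := GF_equiv X h1 h2
  haveI := G_dim (k := k) hf hc m _ h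
  exact hasInjectiveDimensionLT_of_iso
    (show ModuleCat.of A (GT k (FF k Q X)) ≅ X from LinearEquiv.toModuleIso e) (m + 1)

theorem final_iff [FiniteDimensional k A] (X : ModuleCat.{0} A) [Module.Finite A Q]
    [Module.Finite A X]
    (hdom : domdimGE A Q (ModuleCat.of A A) 2)
    (horth : ∀ i, 1 ≤ i → ExtVanish A Q X i)
    (hcodom : codomdimGE A Q X 2) (m : ℕ) :
    idLE A X m ↔
      RelAddDimLE (Module.End A Q) (ModuleCat.of (Module.End A Q) Q) (FF k Q X) m := by
  haveI : FiniteDimensional k Q := Module.Finite.trans A Q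
  haveI : FiniteDimensional k X := Module.Finite.trans A X
  obtain ⟨hf, hc⟩ := dom_cent hdom
  obtain ⟨h1, h2⟩ := codom_AInj (k := k) hcodom
  constructor
  · intro h
    exact main_le hf hc m X inferInstance horth h1 h2 (idLE_imp m X h)
  · intro h
    exact idLE_of m X (le_main hf hc m X h1 h2 h)

end GG
end Aux
end Paper
end Helpers5

noncomputable section Statement5
open Paper

/-- Lemma 2.7(i): if `Q`-domdim of `A` is at least `2`,
`Ext^{i>0}_A(Q, X) = 0` and `Q`-codomdim of `X` is at least `2`, then the injective
dimension of `X` over `A` equals the relative `add Q_Λ`-dimension of the right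
`Λ`-module `D Hom_A(Q, X)`, where `Λ = End_A(Q)^op` (so that right `Λ`-modules are
left `End_A(Q)`-modules). -/
theorem stmt5 (k : Type) [Field k] (A : Type) [Ring A] [Algebra k A] [FiniteDimensional k A]
    (Q X : ModuleCat.{0} A) [Module.Finite A Q] [Module.Finite A X]
    (hdom : domdimGE A Q (ModuleCat.of A A) 2)
    (horth : ∀ i, 1 ≤ i → ExtVanish A Q X i)
    (hcodom : codomdimGE A Q X 2) :
    idDim A X =
      sInf {c : ℕ∞ | ∃ m : ℕ, c = m ∧
        RelAddDimLE (Module.End A Q) (ModuleCat.of (Module.End A Q) Q)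
          (Dunop k (Module.End A Q)
            (ModuleCat.of (Module.End A Q)ᵐᵒᵖ (Q →ₗ[A] X))) m} := by
  have h := Aux.final_iff (k := k) X hdom horth hcodom
  unfold idDim
  congr 1
  ext c
  constructor
  · rintro ⟨m, hm, h'⟩
    exact ⟨m, hm, (h m).1 h'⟩
  · rintro ⟨m, hm, h'⟩
    exact ⟨m, hm, (h m).2 h'⟩

end Statement5
end

section
/- Let A be a finite-dimensional algebra and M a finitely generated A-module with Ext^i_A(M, M) = 0 for all 1 ≤ i ≤ n − 1. If ⋯ → P_1 → P_0 → M → 0 is a minimal projective resolution of M, then there is an exact sequence 0 → Hom_A(M, M) → Hom_A(P_0, M) → ⋯ → Hom_A(P_n, M) → D Hom_A(M, τ_n M) → 0, where τ_n = τ ∘ Ω^{n−1} is the n-th Auslander–Reiten translation. -/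
universe u
open MulOpposite

noncomputable section Helpers6
open Paper MulOpposite

/-- Uniqueness of projective covers, for maps with the same image. -/
lemma h6_cover_unique {A : Type} [Ring A] {P P' X : ModuleCat.{0} A}
    (p : P →ₗ[A] X) (p' : P' →ₗ[A] X) (hP : Module.Projective A P)
    (hP' : Module.Projective A P')
    (hr : LinearMap.range p = LinearMap.range p')
    (hs : Superfluous A (LinearMap.ker p)) (hs' : Superfluous A (LinearMap.ker p')) :
    ∃ α : P ≃ₗ[A] P', ∀ x, p' (α x) = p x := by
  let q : P →ₗ[A] LinearMap.range p' := p.codRestrict _ (fun x => hr ▸ LinearMap.mem_range_self p x)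
  obtain ⟨α, hα⟩ := Module.projective_lifting_property p'.rangeRestrict q
    p'.surjective_rangeRestrict
  have hα' : ∀ x, p' (α x) = p x := fun x => by
    have := congrArg Subtype.val (LinearMap.congr_fun hα x)
    exact this
  have hsurj : LinearMap.range α = ⊤ := by
    apply hs'
    rw [eq_top_iff]
    intro y _
    have : p' y ∈ LinearMap.range p := hr ▸ LinearMap.mem_range_self p' y
    obtain ⟨x, hx⟩ := this
    refine Submodule.mem_sup.2 ⟨α x, ⟨x, rfl⟩, y - α x, ?_, by abel⟩
    rw [LinearMap.mem_ker, map_sub, hα', hx, sub_self]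
  obtain ⟨β, hβ⟩ := Module.projective_lifting_property α LinearMap.id
    (LinearMap.range_eq_top.1 hsurj)
  have hβ' : ∀ y, α (β y) = y := fun y => LinearMap.congr_fun hβ y
  have hsurjβ : LinearMap.range β = ⊤ := by
    apply hs
    rw [eq_top_iff]
    intro x _
    refine Submodule.mem_sup.2 ⟨β (α x), ⟨_, rfl⟩, x - β (α x), ?_, by abel⟩
    rw [LinearMap.mem_ker, map_sub, ← hα' (β (α x)), hβ', hα', sub_self]
  have hinv : ∀ x, β (α x) = x := fun x => by
    obtain ⟨y, rfl⟩ := LinearMap.range_eq_top.1 hsurjβ x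
    rw [hβ']
  exact ⟨LinearEquiv.ofLinear α β hβ (LinearMap.ext hinv), hα'⟩

/-- A cover of a finite module is finite. -/
lemma h6_cover_finite {A : Type} [Ring A] {P X : ModuleCat.{0} A}
    (p : P →ₗ[A] X) (hs : Superfluous A (LinearMap.ker p))
    (hf : Module.Finite A (LinearMap.range p)) : Module.Finite A P := by
  obtain ⟨n, f, hf⟩ := Module.Finite.exists_fin' A (LinearMap.range p)
  obtain ⟨v, hv⟩ := Module.projective_lifting_property p.rangeRestrict f
    p.surjective_rangeRestrict
  have hv' : ∀ x, p (v x) = f x := fun x => congrArg Subtype.val (LinearMap.congr_fun hv x)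
  have : LinearMap.range v = ⊤ := by
    apply hs
    rw [eq_top_iff]
    intro y _
    obtain ⟨x, hx⟩ := hf (p.rangeRestrict y)
    refine Submodule.mem_sup.2 ⟨v x, ⟨x, rfl⟩, y - v x, ?_, by abel⟩
    rw [LinearMap.mem_ker, map_sub, hv', hx]
    simp
  exact Module.Finite.of_surjective v (LinearMap.range_eq_top.1 this)

lemma h6_res_finite {A : Type} [Ring A] [IsNoetherianRing A] {M : ModuleCat.{0} A}
    [Module.Finite A M] (R : ProjRes A M)
    (hminaug : Superfluous A (LinearMap.ker R.aug))
    (hmind : ∀ j, Superfluous A (LinearMap.ker (R.d j))) :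
    ∀ j, Module.Finite A (R.P j)
  | 0 => h6_cover_finite R.aug hminaug inferInstance
  | (j+1) => by
    have := h6_res_finite R hminaug hmind j
    exact h6_cover_finite (R.d j) (hmind j) inferInstance

/-- The augmentation `P_n → Ω^n M`. -/
lemma h6_omega {A : Type} [Ring A] : ∀ (n : ℕ) (X Z : ModuleCat.{0} A) (R : ProjRes A X)
    (_ : Superfluous A (LinearMap.ker R.aug))
    (_ : ∀ j, Superfluous A (LinearMap.ker (R.d j))) (_ : IsOmegaOf A n X Z),
    ∃ aug : R.P n →ₗ[A] Z, Function.Surjective aug ∧ Superfluous A (LinearMap.ker aug) ∧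
      Function.Exact (R.d n) aug
  | 0, X, Z, R, h0, h1, hZ => by
    obtain ⟨σ⟩ := hZ
    refine ⟨σ.symm.toLinearMap ∘ₗ R.aug, σ.symm.surjective.comp R.augSurj, ?_, ?_⟩
    · rwa [LinearEquiv.ker_comp]
    · intro x
      rw [← R.exact0 x]
      simp
  | (n+1), X, Z, R, h0, h1, hZ => by
    obtain ⟨Y, ⟨P, p, ⟨hP, hps, hpk⟩, ⟨σ⟩⟩, hY⟩ := hZ
    obtain ⟨α, hα⟩ := h6_cover_unique R.aug p (R.proj 0) hP
      (by rw [LinearMap.range_eq_top.2 R.augSurj, LinearMap.range_eq_top.2 hps]) h0 hpk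
    let a0 : R.P 1 →ₗ[A] LinearMap.ker p := (α.toLinearMap ∘ₗ R.d 0).codRestrict _ (fun x => by
      rw [LinearMap.mem_ker]
      show p (α _) = 0
      rw [hα]
      exact (R.exact0 _).2 ⟨x, rfl⟩)
    have ha0 : ∀ x, (a0 x : P) = α (R.d 0 x) := fun x => rfl
    have hk : LinearMap.ker (σ.symm.toLinearMap ∘ₗ a0) = LinearMap.ker (R.d 0) := by
      rw [LinearEquiv.ker_comp]
      ext x
      rw [LinearMap.mem_ker, LinearMap.mem_ker, ← Subtype.coe_inj, ha0]
      simp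
    let R' : ProjRes A Y :=
      { P := fun j => R.P (j+1)
        d := fun j => R.d (j+1)
        aug := σ.symm.toLinearMap ∘ₗ a0
        proj := fun j => R.proj (j+1)
        augSurj := by
          refine σ.symm.surjective.comp ?_
          rintro ⟨y, hy⟩
          have : R.aug (α.symm y) = 0 := by
            rw [← hα, LinearEquiv.apply_symm_apply]; exact hy
          obtain ⟨x, hx⟩ := (R.exact0 _).1 this
          refine ⟨x, Subtype.ext ?_⟩
          rw [ha0, hx, LinearEquiv.apply_symm_apply]
        exact0 := by
          intro x
          rw [← R.exact 0 x, ← LinearMap.mem_ker, hk, LinearMap.mem_ker]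
        exact := fun j => R.exact (j+1) }
    exact h6_omega n Y Z R' (by show Superfluous A (LinearMap.ker (σ.symm.toLinearMap ∘ₗ a0)); rw [hk]; exact h1 0)
      (fun j => h1 (j+1)) hY

/-- Linear algebra: the flip of an embedding onto an annihilator. -/
lemma h6_linalg {k V W : Type} [Field k] [AddCommGroup V] [Module k V] [FiniteDimensional k V]
    [AddCommGroup W] [Module k W] (U : Submodule k V) (J : W →ₗ[k] (V →ₗ[k] k))
    (hJ : Function.Injective J) (hr : ∀ ψ : V →ₗ[k] k, (∀ u ∈ U, ψ u = 0) ↔ ∃ h, J h = ψ) :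
    Function.Surjective J.flip ∧ ∀ v, J.flip v = 0 ↔ v ∈ U := by
  constructor
  · intro w
    obtain ⟨L, hL⟩ := J.exists_leftInverse_of_injective (LinearMap.ker_eq_bot.2 hJ)
    obtain ⟨v, hv⟩ := (Module.evalEquiv k V).surjective (w ∘ₗ L)
    refine ⟨v, ?_⟩
    ext h
    have := LinearMap.congr_fun hv (J h)
    refine Eq.trans (this : J h v = w (L (J h))) ?_
    exact congrArg w (LinearMap.congr_fun hL h)
  · intro v
    constructor
    · intro hv
      by_contra hn
      obtain ⟨ψ, h1, h2⟩ := Submodule.exists_dual_map_eq_bot_of_notMem hn inferInstance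
      have h3 : ∀ u ∈ U, ψ u = 0 := fun u hu => by
        have : ψ u ∈ U.map ψ := ⟨u, hu, rfl⟩
        rw [h2] at this
        exact this
      obtain ⟨h, hh⟩ := (hr ψ).1 h3
      apply h1
      rw [← hh]
      exact LinearMap.congr_fun hv h
    · intro hv
      ext h
      exact (hr (J h)).2 ⟨h, rfl⟩ v hv

lemma h6_dual_basis {A : Type} [Ring A] (P : ModuleCat.{0} A) [Module.Finite A P]
    [Module.Projective A P] :
    ∃ (n : ℕ) (x : Fin n → P) (ξ : Fin n → (P →ₗ[A] A)), ∀ p, ∑ i, ξ i p • x i = p := by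
  obtain ⟨n, f, g, -, -, hfg⟩ := Module.Finite.exists_comp_eq_id_of_projective A P
  refine ⟨n, fun i => f (Pi.single i 1), fun i => LinearMap.proj i ∘ₗ g, fun p => ?_⟩
  have h := LinearMap.congr_fun hfg p
  conv_rhs => rw [← LinearMap.id_apply (R := A) p, ← h, LinearMap.comp_apply, pi_eq_sum_univ' (g p)]
  rw [map_sum]
  refine Finset.sum_congr rfl fun i _ => ?_
  rw [map_smul]
  rfl

lemma h6_homfin (k : Type) [Field k] {A : Type} [Ring A] [Algebra k A] [FiniteDimensional k A]
    (P M : ModuleCat.{0} A) [Module.Finite A P] [Module.Finite A M] :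
    FiniteDimensional k (P →ₗ[A] M) := by
  have h1 : Module.Finite k P := Module.Finite.trans A P
  have h2 : Module.Finite k M := Module.Finite.trans A M
  let r : (P →ₗ[A] M) →ₗ[k] (P →ₗ[k] M) :=
    { toFun := fun f => f.restrictScalars k
      map_add' := fun _ _ => rfl
      map_smul' := fun _ _ => rfl }
  exact FiniteDimensional.of_injective r (LinearMap.restrictScalars_injective k)

/-- The map `p ↦ ξ(p) • m`. -/
def h6_rk {A : Type} [Ring A] {P M : ModuleCat.{0} A} (ξ : P →ₗ[A] A) (m : M) : P →ₗ[A] M :=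
  (LinearMap.toSpanSingleton A M m) ∘ₗ ξ

lemma h6_rk_apply {A : Type} [Ring A] {P M : ModuleCat.{0} A} (ξ : P →ₗ[A] A) (m : M) (p : P) :
    h6_rk ξ m p = ξ p • m := rfl

/-- Elements of `Dunop k A Tr` are linear functionals. -/
def h6_fn {k : Type} [Field k] {A : Type} [Ring A] [Algebra k A] {Tr : ModuleCat.{0} Aᵐᵒᵖ}
    (φ : Dunop k A Tr) : Tr →ₗ[k] k := φ

lemma h6_main (k : Type) [Field k] {A : Type} [Ring A] [Algebra k A] [FiniteDimensional k A]
    (M : ModuleCat.{0} A) [Module.Finite A M] (P1 P0 : ModuleCat.{0} A)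
    [Module.Finite A P1] [Module.Finite A P0] [Module.Projective A P1] [Module.Projective A P0]
    (g : P1 →ₗ[A] P0) (Tr : ModuleCat.{0} Aᵐᵒᵖ) (q : (P1 →ₗ[A] A) →ₗ[Aᵐᵒᵖ] Tr)
    (hq : Function.Surjective q) (hqk : ∀ ξ, q ξ = 0 ↔ ∃ η : P0 →ₗ[A] A, η ∘ₗ g = ξ)
    (T : ModuleCat.{0} A) (t : T ≃ₗ[A] Dunop k A Tr) :
    ∃ e : (P1 →ₗ[A] M) →ₗ[k] ((M →ₗ[A] T) →ₗ[k] k), Function.Surjective e ∧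
      Function.Exact (pcompk k A (Z := M) g) e := by
  have := h6_homfin k P1 M
  obtain ⟨n, x, ξ, hx⟩ := h6_dual_basis P1
  obtain ⟨n0, y, η, hy⟩ := h6_dual_basis P0
  let ev : T → Tr → k := fun a b => (h6_fn (t a)) b
  have ev_add : ∀ a a' b, ev (a + a') b = ev a b + ev a' b := fun a a' b => by
    show (h6_fn (t (a + a'))) b = _
    rw [map_add]; rfl
  have ev_smul : ∀ (c : A) a b, ev (c • a) b = ev a (op c • b) := fun c a b => by
    show (h6_fn (t (c • a))) b = _
    rw [map_smul]; rfl
  have ev_radd : ∀ a b b', ev a (b + b') = ev a b + ev a b' := fun a b b' =>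
    map_add (h6_fn (t a)) b b'
  have ev_r0 : ∀ a, ev a 0 = 0 := fun a => map_zero (h6_fn (t a))
  have ev_rsmul : ∀ (c : k) a b, ev a (c • b) = c * ev a b := fun c a b =>
    map_smul (h6_fn (t a)) c b
  have ev_rsum : ∀ {m : ℕ} a (b : Fin m → Tr), ev a (∑ i, b i) = ∑ i, ev a (b i) := fun a b =>
    map_sum (h6_fn (t a)) b _
  have ev_ksmul : ∀ (c : k) a b, ev (c • a) b = c * ev a b := fun c a b => by
    rw [← ev_rsmul]
    exact ev_smul (algebraMap k A c) a b
  let J : (M →ₗ[A] T) →ₗ[k] ((P1 →ₗ[A] M) →ₗ[k] k) := LinearMap.mk₂ k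
    (fun h f => ∑ i, ev (h (f (x i))) (q (ξ i)))
    (fun h h' f => by simp only [LinearMap.add_apply, ev_add, Finset.sum_add_distrib])
    (fun c h f => by simp only [LinearMap.smul_apply, ev_ksmul, Finset.mul_sum, smul_eq_mul])
    (fun h f f' => by simp only [LinearMap.add_apply, map_add, ev_add, Finset.sum_add_distrib])
    (fun c h f => by
      simp only [LinearMap.smul_apply, Finset.mul_sum, smul_eq_mul]
      refine Finset.sum_congr rfl fun i _ => ?_
      rw [← ev_ksmul]
      exact congrArg (fun z => ev z _) (h.map_smul (algebraMap k A c) _))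
  have hJ : ∀ h f, J h f = ∑ i, ev (h (f (x i))) (q (ξ i)) := fun _ _ => rfl
  have hexp : ∀ ζ : P1 →ₗ[A] A, ∑ i, op (ζ (x i)) • ξ i = ζ := fun ζ => by
    ext p
    conv_rhs => rw [← hx p, map_sum]
    simp [LinearMap.sum_apply]
  have key : ∀ h (ζ : P1 →ₗ[A] A) m, J h (h6_rk ζ m) = ev (h m) (q ζ) := fun h ζ m => by
    rw [hJ]
    conv_rhs => rw [← hexp ζ, map_sum, ev_rsum]
    refine Finset.sum_congr rfl fun i _ => ?_
    rw [h6_rk_apply, map_smul, ev_smul, map_smul]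
  have hf1 : ∀ f : P1 →ₗ[A] M, ∑ i, h6_rk (ξ i) (f (x i)) = f := fun f => by
    ext p
    conv_rhs => rw [← hx p, map_sum]
    simp [LinearMap.sum_apply, h6_rk_apply]
  have hf0 : ∀ f : P0 →ₗ[A] M, ∑ i, h6_rk (η i ∘ₗ g) (f (y i)) = f ∘ₗ g := fun f => by
    ext p
    conv_rhs => rw [LinearMap.comp_apply, ← hy (g p), map_sum]
    simp [LinearMap.sum_apply, h6_rk_apply]
  have rk_add : ∀ (ζ ζ' : P1 →ₗ[A] A) (m : M), h6_rk (ζ + ζ') m = h6_rk ζ m + h6_rk ζ' m :=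
    fun ζ ζ' m => by ext p; simp [h6_rk_apply, add_smul]
  have rk_addr : ∀ (ζ : P1 →ₗ[A] A) (m m' : M), h6_rk ζ (m + m') = h6_rk ζ m + h6_rk ζ m' :=
    fun ζ m m' => by ext p; simp [h6_rk_apply]
  have rk_sub : ∀ (ζ ζ' : P1 →ₗ[A] A) (m : M), h6_rk (ζ - ζ') m = h6_rk ζ m - h6_rk ζ' m :=
    fun ζ ζ' m => by ext p; simp [h6_rk_apply, sub_smul]
  have rk_smul : ∀ (ζ : P1 →ₗ[A] A) (b : A) (m : M), h6_rk (op b • ζ) m = h6_rk ζ (b • m) :=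
    fun ζ b m => by ext p; simp [h6_rk_apply, mul_smul]
  have rk_k : ∀ (ζ : P1 →ₗ[A] A) (c : k) (m : M),
      h6_rk ζ (algebraMap k A c • m) = c • h6_rk ζ m :=
    fun ζ c m => by
      ext p
      rw [LinearMap.smul_apply, h6_rk_apply, h6_rk_apply]
      exact smul_comm (ζ p) c m
  have hinj : Function.Injective J := by
    rw [injective_iff_map_eq_zero]
    intro h hh
    ext m
    apply t.injective
    rw [LinearMap.zero_apply, map_zero]
    refine LinearMap.ext (fun b => ?_ : ∀ b, (h6_fn (t (h m))) b = 0)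
    obtain ⟨ζ, rfl⟩ := hq b
    show ev (h m) (q ζ) = 0
    rw [← key, hh]; rfl
  have hr : ∀ ψ : (P1 →ₗ[A] M) →ₗ[k] k,
      (∀ u ∈ LinearMap.range (pcompk k A (Z := M) g), ψ u = 0) ↔ ∃ h, J h = ψ := by
    intro ψ
    constructor
    · intro hψ
      have wd : ∀ ζ ζ' (m : M), q ζ = q ζ' → ψ (h6_rk ζ m) = ψ (h6_rk ζ' m) := by
        intro ζ ζ' m hz
        obtain ⟨θ, hθ⟩ := (hqk (ζ - ζ')).1 (by rw [map_sub, hz, sub_self])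
        rw [← sub_eq_zero, ← map_sub, ← rk_sub, ← hθ]
        exact hψ _ ⟨h6_rk θ m, rfl⟩
      let s := Function.surjInv hq
      have hs : ∀ b, q (s b) = b := Function.surjInv_eq hq
      let φ : M → (Tr →ₗ[k] k) := fun m =>
        { toFun := fun b => ψ (h6_rk (s b) m)
          map_add' := fun b b' => by
            rw [← map_add, ← rk_add]
            apply wd
            rw [map_add, hs, hs, hs]
          map_smul' := fun c b => by
            rw [RingHom.id_apply, ← map_smul, ← rk_k, ← rk_smul]
            apply wd
            rw [map_smul, hs, hs]
            rfl }
      have hφ : ∀ m b, φ m b = ψ (h6_rk (s b) m) := fun _ _ => rfl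
      let φ' : M →ₗ[A] Dunop k A Tr :=
        { toFun := fun m => φ m
          map_add' := fun m m' => by
            refine LinearMap.ext (fun b => ?_ : ∀ b, φ (m + m') b = φ m b + φ m' b)
            rw [hφ, hφ, hφ, rk_addr, map_add]
          map_smul' := fun c m => by
            refine LinearMap.ext (fun b => ?_ : ∀ b, φ (c • m) b = φ m (op c • b))
            rw [hφ, hφ, ← rk_smul]
            apply wd
            rw [map_smul, hs, hs] }
      refine ⟨t.symm.toLinearMap ∘ₗ φ', ?_⟩
      ext f
      conv_rhs => rw [← hf1 f, map_sum]
      rw [hJ]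
      refine Finset.sum_congr rfl fun i _ => ?_
      show (h6_fn (t (t.symm (φ' (f (x i)))))) (q (ξ i)) = _
      rw [LinearEquiv.apply_symm_apply]
      show φ _ _ = _
      rw [hφ]
      apply wd
      rw [hs]
    · rintro ⟨h, rfl⟩ _ ⟨f, rfl⟩
      show J h (f ∘ₗ g) = 0
      rw [← hf0, map_sum]
      refine Finset.sum_eq_zero fun i _ => ?_
      rw [key, (hqk _).2 ⟨η i, rfl⟩, ev_r0]
  obtain ⟨h1, h2⟩ := h6_linalg _ J hinj hr
  exact ⟨J.flip, h1, fun v => (h2 v)⟩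

end Helpers6

noncomputable section Statement6
open Paper

/-- Lemma 2.9, Li–Zhang: if `Ext^i_A(M, M) = 0` for `1 ≤ i ≤ n − 1`
(here `n = n₀ + 1`) and `P• → M` is a minimal projective resolution, then there is an
exact sequence
`0 → Hom(M,M) → Hom(P_0,M) → ⋯ → Hom(P_n,M) → D Hom_A(M, τ_n M) → 0`,
where the maps between the Hom-spaces are induced by the differentials. -/
theorem stmt6 (k : Type) [Field k] (A : Type) [Ring A] [Algebra k A] [FiniteDimensional k A]
    (M : ModuleCat.{0} A) [Module.Finite A M] (n₀ : ℕ)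
    (R : ProjRes A M)
    (hminaug : Superfluous A (LinearMap.ker R.aug))
    (hmind : ∀ j, Superfluous A (LinearMap.ker (R.d j)))
    (hext : ∀ i, 1 ≤ i → i ≤ n₀ → ExtVanish A M M i)
    (T : ModuleCat.{0} A) (hT : IsTauN k A (n₀ + 1) M T) :
    ∃ e : (R.P (n₀ + 1) →ₗ[A] M) →ₗ[k] ((M →ₗ[A] T) →ₗ[k] k),
      Function.Surjective e ∧
      Function.Injective (pcompk k A (Z := M) R.aug) ∧
      Function.Exact (pcompk k A (Z := M) R.aug) (pcompk k A (Z := M) (R.d 0)) ∧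
      (∀ j, j + 1 ≤ n₀ →
        Function.Exact (pcompk k A (Z := M) (R.d j)) (pcompk k A (Z := M) (R.d (j+1)))) ∧
      Function.Exact (pcompk k A (Z := M) (R.d n₀)) e := by
  have : IsNoetherianRing A := IsNoetherianRing.of_finite k A
  have hfin := h6_res_finite R hminaug hmind
  obtain ⟨Z, hZ, Tr, ⟨P1, P0, g, p, ⟨hP0, hps, hpk⟩, hP1, hgp, hgk, ⟨σ⟩⟩, ⟨t⟩⟩ := hT
  obtain ⟨aug, ha, hak, hae⟩ := h6_omega n₀ M Z R hminaug hmind hZ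
  obtain ⟨α0, hα0⟩ := h6_cover_unique aug p (R.proj n₀) hP0
    (by rw [LinearMap.range_eq_top.2 ha, LinearMap.range_eq_top.2 hps]) hak hpk
  obtain ⟨α1, hα1⟩ := h6_cover_unique (α0.toLinearMap ∘ₗ R.d n₀) g (R.proj (n₀ + 1)) hP1
    (by
      ext y
      constructor
      · rintro ⟨x, rfl⟩
        refine (hgp _).1 ?_
        show p (α0 _) = 0
        rw [hα0]
        exact (hae _).2 ⟨x, rfl⟩
      · intro hy
        have h0 : aug (α0.symm y) = 0 := by
          rw [← hα0, LinearEquiv.apply_symm_apply]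
          exact (hgp _).2 hy
        obtain ⟨x, hx⟩ := (hae _).1 h0
        refine ⟨x, ?_⟩
        rw [LinearMap.comp_apply, hx]
        exact α0.apply_symm_apply y)
    (by rw [LinearEquiv.ker_comp]; exact hmind n₀) hgk
  have f1 := hfin (n₀ + 1)
  have f0 := hfin n₀
  have : Module.Finite A P1 := Module.Finite.equiv α1
  have : Module.Finite A P0 := Module.Finite.equiv α0
  obtain ⟨e, he, hee⟩ := h6_main k M P1 P0 g Tr
    (σ.symm.toLinearMap ∘ₗ (LinearMap.range (lprecomp A g)).mkQ)
    (σ.symm.surjective.comp (Submodule.mkQ_surjective _))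
    (fun ξ => by
      rw [← LinearMap.mem_ker, LinearEquiv.ker_comp, Submodule.ker_mkQ]
      rfl) T t
  refine ⟨e ∘ₗ pcompk k A (Z := M) α1.symm.toLinearMap, ?_, ?_, ?_, ?_, ?_⟩
  · refine he.comp fun f => ⟨f ∘ₗ α1.toLinearMap, ?_⟩
    ext x
    show f (α1 (α1.symm x)) = f x
    rw [LinearEquiv.apply_symm_apply]
  · intro f f' hff
    ext m
    obtain ⟨x, rfl⟩ := R.augSurj m
    exact LinearMap.congr_fun hff x
  · intro f
    constructor
    · intro hf
      have hf' : ∀ x, f (R.d 0 x) = 0 := fun x => LinearMap.congr_fun hf x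
      have hker : LinearMap.ker R.aug ≤ LinearMap.ker f := by
        intro x hx
        obtain ⟨z, rfl⟩ := (R.exact0 x).1 hx
        exact hf' z
      refine ⟨(LinearMap.ker R.aug).liftQ f hker ∘ₗ
        (R.aug.quotKerEquivOfSurjective R.augSurj).symm.toLinearMap, ?_⟩
      ext x
      show (LinearMap.ker R.aug).liftQ f hker
        ((R.aug.quotKerEquivOfSurjective R.augSurj).symm (R.aug x)) = f x
      have : (R.aug.quotKerEquivOfSurjective R.augSurj).symm (R.aug x)
          = (LinearMap.ker R.aug).mkQ x := by
        rw [LinearEquiv.symm_apply_eq]; rfl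
      rw [this]; rfl
    · rintro ⟨h, rfl⟩
      ext x
      show h (R.aug (R.d 0 x)) = 0
      rw [(R.exact0 _).2 ⟨x, rfl⟩, map_zero]
  · intro j hj f
    constructor
    · intro hf
      obtain ⟨h, hh⟩ := hext (j + 1) (by omega) hj R f hf
      exact ⟨h, hh.symm⟩
    · rintro ⟨h, rfl⟩
      ext x
      show h (R.d j (R.d (j + 1) x)) = 0
      rw [(R.exact j _).2 ⟨x, rfl⟩, map_zero]
  · intro f
    show e (f ∘ₗ α1.symm.toLinearMap) = 0 ↔ _
    rw [hee]
    constructor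
    · rintro ⟨h, hh⟩
      refine ⟨h ∘ₗ α0.toLinearMap, ?_⟩
      ext x
      show h (α0 (R.d n₀ x)) = f x
      have h1 : h (g (α1 x)) = f (α1.symm (α1 x)) := LinearMap.congr_fun hh (α1 x)
      rw [hα1, LinearEquiv.symm_apply_apply] at h1
      exact h1
    · rintro ⟨h, rfl⟩
      refine ⟨h ∘ₗ α0.symm.toLinearMap, ?_⟩
      ext x
      show h (α0.symm (g x)) = h (R.d n₀ (α1.symm x))
      have h1 : g (α1 (α1.symm x)) = α0 (R.d n₀ (α1.symm x)) := hα1 _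
      rw [LinearEquiv.apply_symm_apply] at h1
      rw [h1, LinearEquiv.symm_apply_apply]

end Statement6
end
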